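/- Let E and F be directed graphs with no sinks, both satisfying Conditions (K), (W) and (∞). Let Γ be a subgroup of G_E containing the commutator subgroup of G_E, and let Λ be a subgroup of G_F containing the commutator subgroup of G_F. Then every abstract group isomorphism Φ : Γ → Λ is spatially implemented: there exists a homeomorphism φ : ∂E → ∂F such that Φ(γ) = φ ∘ γ ∘ φ⁻¹ for every γ ∈ Γ. -/

import Mathlib

/-! ## Directed graphs, paths, and the boundary path space -/

/-- A directed graph: edge set `E`, vertex set `V`, source and range maps. -/
structure DGraph (V : Type*) (E : Type*) where
  s : E → V
  r : E → V

variable {V E : Type*}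

/-- A finite path in a directed graph: a base (source) vertex together with a finite
sequence of composable edges; vertices are the trivial paths. -/
structure FinPath (G : DGraph V E) where
  src : V
  edges : List E
  src_eq : ∀ e ∈ edges.head?, G.s e = src
  chain : edges.Chain' fun e f => G.r e = G.s f

namespace FinPath

variable {G : DGraph V E}

/-- The range (terminal vertex) of a finite path. -/
def rng (μ : FinPath G) : V := μ.edges.getLast?.elim μ.src G.r

/-- `μ ≤ ν`: `ν` extends `μ`, i.e. `ν = μλ` for some (possibly trivial) path `λ`. -/
def Le (μ ν : FinPath G) : Prop := μ.src = ν.src ∧ μ.edges <+: ν.edges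

/-- Two finite paths are disjoint if neither is an initial segment of the other. -/
def Disjoint (μ ν : FinPath G) : Prop := ¬ Le μ ν ∧ ¬ Le ν μ

/-- A cycle: a nontrivial path returning to its base vertex. -/
def IsCycle (μ : FinPath G) : Prop := μ.edges ≠ [] ∧ μ.rng = μ.src

/-- A return path: a cycle not passing through its base vertex in between. -/
def IsReturnPath (μ : FinPath G) : Prop :=
  IsCycle μ ∧ ∀ (i : ℕ) (h : i + 1 < μ.edges.length),
    G.r (μ.edges.get ⟨i, Nat.lt_of_succ_lt h⟩) ≠ μ.rng

/-- A path has an exit. -/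
def HasExit (μ : FinPath G) : Prop :=
  ∃ (i : Fin μ.edges.length) (e : E),
    G.s e = G.s (μ.edges.get i) ∧ e ≠ μ.edges.get i

end FinPath

/-- The trivial path at a vertex. -/
def trivialPath (G : DGraph V E) (v : V) : FinPath G :=
  ⟨v, [], by intro e he; simp at he, List.IsChain.nil⟩

/-- An infinite path in a directed graph. -/
structure InfPath (G : DGraph V E) where
  edges : ℕ → E
  chain : ∀ i, G.r (edges i) = G.s (edges (i + 1))

/-- The source vertex of an infinite path. -/
def InfPath.src {G : DGraph V E} (x : InfPath G) : V := G.s (x.edges 0)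

/-- A wandering infinite path: it visits each vertex only finitely often. -/
def Wandering {G : DGraph V E} (x : InfPath G) : Prop :=
  ∀ v : V, {i : ℕ | G.s (x.edges i) = v}.Finite

/-- A semi-tail: a wandering infinite path each of whose edges is the unique edge emitted
by its source. -/
def IsSemiTail {G : DGraph V E} (x : InfPath G) : Prop :=
  Wandering x ∧ ∀ i, ∀ e : E, G.s e = G.s (x.edges i) → e = x.edges i

/-- A sink: a vertex emitting no edges. -/
def IsSink (G : DGraph V E) (v : V) : Prop := ∀ e : E, G.s e ≠ v

/-- An infinite emitter. -/
def InfEmitter (G : DGraph V E) (v : V) : Prop := {e : E | G.s e = v}.Infinite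

/-- A singular vertex: a sink or an infinite emitter. -/
def Singular (G : DGraph V E) (v : V) : Prop := IsSink G v ∨ InfEmitter G v

/-- `v ≥ w`: there is a finite path from `v` to `w`. -/
def Reaches (G : DGraph V E) (v w : V) : Prop :=
  ∃ μ : FinPath G, μ.src = v ∧ μ.rng = w

/-- Condition (L): every cycle has an exit. -/
def CondL (G : DGraph V E) : Prop :=
  ∀ μ : FinPath G, μ.IsCycle → μ.HasExit

/-- Condition (T): from every vertex there are at least two distinct paths to some common
vertex. -/
def CondT (G : DGraph V E) : Prop :=
  ∀ v : V, ∃ μ ν : FinPath G, μ ≠ ν ∧ μ.src = v ∧ ν.src = v ∧ μ.rng = ν.rng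

/-- Condition (K): every vertex supports either no return path or at least two. -/
def CondK (G : DGraph V E) : Prop :=
  ∀ v : V, (¬ ∃ μ : FinPath G, μ.IsReturnPath ∧ μ.src = v) ∨
    (∃ μ ν : FinPath G, μ ≠ ν ∧ μ.IsReturnPath ∧ ν.IsReturnPath ∧ μ.src = v ∧ ν.src = v)

/-- Condition (W): every wandering infinite path admits a second route from its source to
the range of one of its edges. -/
def CondW (G : DGraph V E) : Prop :=
  ∀ x : InfPath G, Wandering x →
    ∃ (n : ℕ) (μ ν : FinPath G), μ ≠ ν ∧ μ.src = x.src ∧ ν.src = x.src ∧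
      μ.rng = G.r (x.edges n) ∧ ν.rng = G.r (x.edges n)

/-- Condition (∞): every infinite emitter emits infinitely many edges whose ranges can
reach back. -/
def CondInf (G : DGraph V E) : Prop :=
  ∀ v : V, InfEmitter G v → {e : E | G.s e = v ∧ Reaches G (G.r e) v}.Infinite

/-- Cofinality: every vertex can reach some vertex on every infinite path. -/
def Cofinal (G : DGraph V E) : Prop :=
  ∀ (v : V) (x : InfPath G), ∃ n : ℕ, Reaches G v (G.s (x.edges n))

/-- The boundary path space: all infinite paths together with all finite paths ending at a
singular vertex. -/
def BPath (G : DGraph V E) : Type _ :=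
  {μ : FinPath G // Singular G μ.rng} ⊕ InfPath G

namespace BPath

variable {G : DGraph V E}

/-- The source vertex of a boundary path. -/
def src : BPath G → V
  | Sum.inl p => p.1.src
  | Sum.inr x => x.src

/-- The `n`-th edge of a boundary path (0-indexed), if it exists. -/
def edgeAt : BPath G → ℕ → Option E
  | Sum.inl p, n => p.1.edges[n]?
  | Sum.inr x, n => some (x.edges n)

end BPath

/-- A finite path `μ` is an initial segment of a boundary path `p`. -/
def IsPrefixOf {G : DGraph V E} (μ : FinPath G) (p : BPath G) : Prop :=
  μ.src = p.src ∧ ∀ i, i < μ.edges.length → p.edgeAt i = μ.edges[i]?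

/-- The cylinder set `Z(μ)` of a finite path. -/
def ZSet {G : DGraph V E} (μ : FinPath G) : Set (BPath G) :=
  {p | IsPrefixOf μ p}

/-- The basic set `Z(μ∖F) = Z(μ) ∖ ⋃_{e ∈ F} Z(μe)`. -/
def ZMinus {G : DGraph V E} (μ : FinPath G) (F : Set E) : Set (BPath G) :=
  {p | IsPrefixOf μ p ∧ ∀ e ∈ F, p.edgeAt μ.edges.length ≠ some e}

/-- The topology on the boundary path space generated by the basic sets `Z(μ∖F)`. -/
instance bpathTopology {G : DGraph V E} : TopologicalSpace (BPath G) :=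
  TopologicalSpace.generateFrom
    {S | ∃ (μ : FinPath G) (F : Set E), F.Finite ∧ (∀ e ∈ F, G.s e = μ.rng) ∧ S = ZMinus μ F}

/-- Tail equivalence of boundary paths. -/
def TailEquiv {G : DGraph V E} : BPath G → BPath G → Prop
  | Sum.inl p, Sum.inl q => p.1.rng = q.1.rng
  | Sum.inr x, Sum.inr y => ∃ k l : ℕ, ∀ n : ℕ, x.edges (k + n) = y.edges (l + n)
  | Sum.inl _, Sum.inr _ => False
  | Sum.inr _, Sum.inl _ => False

/-- `q = μz` where `p = λz`: the boundary path `q` is obtained from `p` by replacing the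
initial segment `λ` with `μ`. -/
def IsShiftedBy {G : DGraph V E} (lam μ : FinPath G) (p q : BPath G) : Prop :=
  IsPrefixOf μ q ∧
    ∀ n : ℕ, p.edgeAt (lam.edges.length + n) = q.edgeAt (μ.edges.length + n)

/-- Membership in the topological full group of the graph groupoid: a homeomorphism `α` of
`∂E` given by finitely many prefix-exchanges `(μᵢ, Fᵢ, λᵢ)` and equal to the identity off
their common (compact open) support. -/
def InFullGroup (G : DGraph V E) (α : BPath G ≃ₜ BPath G) : Prop :=
  ∃ (k : ℕ) (μ lam : Fin k → FinPath G) (F : Fin k → Set E),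
    (∀ i, (μ i).rng = (lam i).rng) ∧
    (∀ i, (F i).Finite) ∧
    (∀ i, F i ⊂ {e : E | G.s e = (μ i).rng}) ∧
    (∀ i j, i ≠ j → ZMinus (lam i) (F i) ∩ ZMinus (lam j) (F j) = ∅) ∧
    (∀ i j, i ≠ j → ZMinus (μ i) (F i) ∩ ZMinus (μ j) (F j) = ∅) ∧
    (⋃ i, ZMinus (lam i) (F i)) = (⋃ i, ZMinus (μ i) (F i)) ∧
    (∀ i, ∀ p ∈ ZMinus (lam i) (F i), IsShiftedBy (lam i) (μ i) p (α p)) ∧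
    (∀ p ∉ ⋃ i, ZMinus (lam i) (F i), α p = p)

instance homeoGroup (X : Type*) [TopologicalSpace X] : Group (X ≃ₜ X) where
  mul f g := g.trans f
  one := Homeomorph.refl X
  inv := Homeomorph.symm
  mul_assoc _ _ _ := Homeomorph.ext fun _ => rfl
  one_mul _ := Homeomorph.ext fun _ => rfl
  mul_one _ := Homeomorph.ext fun _ => rfl
  inv_mul_cancel f := Homeomorph.ext f.symm_apply_apply

open scoped commutatorElement


/-! ## Abstract reconstruction theorem -/

structure SRGood (A X : Type*) [Group A] [MulAction A X] [TopologicalSpace X] : Prop where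
  t2 : T2Space X
  cont : ∀ a : A, Continuous fun x : X => a • x
  faith : ∀ a : A, (∀ x : X, a • x = x) → a = 1
  p1 : ∀ (x : X) (U : Set X), IsOpen U → x ∈ U →
    ∃ t : A, t * t = 1 ∧ t • x ≠ x ∧ ∀ z : X, t • z ≠ z → z ∈ U
  p2 : ∀ t : A, t * t = 1 → ∀ x : X, t • x ≠ x → ∀ U : Set X, IsOpen U → x ∈ U →
    ∃ b : A, b • x ≠ x ∧ ∀ z : X, b • z ≠ z → b • z = t • z ∧ (z ∈ U ∨ t • z ∈ U)
  p3 : ∀ t : A, t * t = 1 → IsCompact {x : X | t • x ≠ x}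

section Definable

variable {A : Type*} [Group A]

def srU (t : A) : Set A :=
  {s | s * t = t * s ∧ s * s = 1 ∧ ∀ g, g * t = t * g → s * (g * s * g⁻¹) = (g * s * g⁻¹) * s}

def srC (t : A) : Set A := {r | ∀ s ∈ srU t, r * s = s * r}

def srW (t : A) : Set A := {a | ∀ r ∈ srC t, a * (r * r) = (r * r) * a}

theorem srU_map {B : Type*} [Group B] (Φ : A ≃* B) (t s : A) : s ∈ srU t ↔ Φ s ∈ srU (Φ t) := by
  unfold srU
  simp only [Set.mem_setOf_eq]
  rw [← map_mul, ← map_mul, Φ.injective.eq_iff, ← map_mul, ← map_one Φ, Φ.injective.eq_iff]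
  refine and_congr_right fun _ => and_congr_right fun _ => ?_
  rw [Φ.surjective.forall]
  refine forall_congr' fun g => ?_
  simp only [← map_mul, ← map_inv, Φ.injective.eq_iff]

theorem srC_map {B : Type*} [Group B] (Φ : A ≃* B) (t s : A) : s ∈ srC t ↔ Φ s ∈ srC (Φ t) := by
  unfold srC
  simp only [Set.mem_setOf_eq]
  rw [Φ.surjective.forall]
  refine forall_congr' fun g => ?_
  simp only [← map_mul, Φ.injective.eq_iff, ← srU_map]

theorem srW_map {B : Type*} [Group B] (Φ : A ≃* B) (t s : A) : s ∈ srW t ↔ Φ s ∈ srW (Φ t) := by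
  unfold srW
  simp only [Set.mem_setOf_eq]
  rw [Φ.surjective.forall]
  refine forall_congr' fun g => ?_
  simp only [← map_mul, Φ.injective.eq_iff, ← srC_map]

end Definable

namespace SRGood

variable {A X : Type*} [Group A] [MulAction A X] [TopologicalSpace X]

theorem ext (h : SRGood A X) {a b : A} (hab : ∀ x : X, a • x = b • x) : a = b := by
  have := h.faith (b⁻¹ * a) (fun x => by rw [mul_smul, hab, inv_smul_smul])
  rwa [inv_mul_eq_one, eq_comm] at this

theorem invol {t : A} (ht : t * t = 1) (x : X) : t • t • x = x := by
  rw [← mul_smul, ht, one_smul]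

/-- an open neighbourhood displaced by `a` -/
theorem sep (h : SRGood A X) (a : A) (x : X) (hx : a • x ≠ x) (U : Set X) (hU : IsOpen U)
    (hxU : x ∈ U) : ∃ N : Set X, IsOpen N ∧ x ∈ N ∧ N ⊆ U ∧ ∀ z ∈ N, a • z ∉ N := by
  haveI := h.t2
  obtain ⟨P, Q, hP, hQ, hxP, hxQ, hd⟩ := t2_separation hx
  refine ⟨U ∩ Q ∩ (fun z => a • z) ⁻¹' P, (hU.inter hQ).inter (hP.preimage (h.cont a)),
    ⟨⟨hxU, hxQ⟩, hxP⟩, fun z hz => hz.1.1, fun z hz hz' => ?_⟩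
  exact Set.disjoint_left.1 hd hz.2 hz'.1.2

/-- if `g` is supported in `N` then `N` is invariant -/
theorem maps_of_supp {g : A} {N : Set X} (hg : ∀ z : X, g • z ≠ z → z ∈ N) {z : X} (hz : z ∈ N) :
    g • z ∈ N := by
  by_cases hh : g • z = z
  · rwa [hh]
  · apply hg
    intro h2
    exact hh (smul_left_cancel g h2)

theorem fix_of_supp {g : A} {N : Set X} (hg : ∀ z : X, g • z ≠ z → z ∈ N) {z : X} (hz : z ∉ N) :
    g • z = z := by
  by_contra hh
  exact hz (hg z hh)

theorem supp_inv {g : A} {N : Set X} (hg : ∀ z : X, g • z ≠ z → z ∈ N) :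
    ∀ z : X, g⁻¹ • z ≠ z → z ∈ N := by
  intro z hz
  apply hg
  intro h2
  apply hz
  rw [inv_smul_eq_iff, h2]

/-- F3 -/
theorem f3 (h : SRGood A X) (x : X) (U : Set X) (hU : IsOpen U) (hx : x ∈ U) :
    ∃ g : A, (∀ z : X, g • z ≠ z → z ∈ U) ∧ ∃ z ∈ U, (g * g) • z ≠ z := by
  obtain ⟨a, ha, hax, haU⟩ := h.p1 x U hU hx
  obtain ⟨N, hN, hxN, hNU, hd⟩ := h.sep a x hax U hU hx
  obtain ⟨b, hb, hbx, hbN⟩ := h.p1 x N hN hxN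
  refine ⟨a * b, fun z hz => ?_, x, hx, ?_⟩
  · by_contra hzU
    apply hz
    rw [mul_smul, fix_of_supp hbN (fun hh => hzU (hNU hh)), fix_of_supp haU hzU]
  · have hbN' : b • x ∈ N := maps_of_supp hbN hxN
    have : b • a • b • x = a • b • x := fix_of_supp hbN (hd _ hbN')
    rw [mul_smul, mul_smul, mul_smul, this, invol ha]
    exact hbx

theorem isOpen_mv (h : SRGood A X) (t : A) : IsOpen {x : X | t • x ≠ x} := by
  haveI := h.t2
  exact isOpen_ne_fun (h.cont t) continuous_id

theorem isOpen_fix (h : SRGood A X) (t : A) (ht : t * t = 1) : IsOpen {x : X | t • x = x} := by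
  haveI := h.t2
  have := (h.p3 t ht).isClosed.isOpen_compl
  convert this using 1
  ext x; simp

theorem claim1 (h : SRGood A X) {t s : A} (ht : t * t = 1) (hs : s ∈ srU t) (x : X)
    (hx : s • x ≠ x) : t • x ≠ x := by
  intro htx
  obtain ⟨h1, h2, h3⟩ := hs
  obtain ⟨N, hN, hxN, hNU, hd⟩ := h.sep s x hx _ (h.isOpen_fix t ht) htx
  obtain ⟨g, hg, z, hz, hgz⟩ := h.f3 x N hN hxN
  have hgt : g * t = t * g := by
    apply h.ext
    intro w
    rw [mul_smul, mul_smul]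
    by_cases hw : w ∈ N
    · have e1 : t • w = w := hNU hw
      have e2 : t • g • w = g • w := hNU (maps_of_supp hg hw)
      rw [e1, e2]
    · have e1 : t • w ∉ N := by
        intro hh
        have : t • t • w = t • w := hNU hh
        rw [invol ht] at this
        exact hw (this ▸ hh)
      rw [fix_of_supp hg hw, fix_of_supp hg e1]
  have hc := congrArg (fun a : A => a • z) (h3 g hgt)
  simp only [mul_smul] at hc
  have hz' : g⁻¹ • z ∈ N := maps_of_supp (supp_inv hg) hz
  rw [fix_of_supp hg (hd _ hz'), fix_of_supp (supp_inv hg) (hd _ hz), invol h2, invol h2] at hc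
  apply hgz
  rw [mul_smul, ← hc, smul_inv_smul]

theorem memU (h : SRGood A X) {t b : A} (ht : t * t = 1)
    (hb : ∀ z : X, b • z ≠ z → b • z = t • z) : b ∈ srU t := by
  have hbb : ∀ z : X, b • b • z = z := by
    intro z
    by_cases hz : b • z = z
    · rw [hz, hz]
    · rw [hb (b • z) (fun hh => hz (smul_left_cancel b hh)), hb z hz, invol ht]
  have ht' : ∀ z : X, t • t • z = z := invol ht
  -- `b` commutes with `t`
  have hbt : ∀ z : X, b • t • z = t • b • z := by
    intro z
    by_cases hz : b • z = z
    · rw [hz]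
      by_contra hh
      have := hb _ hh
      rw [ht'] at this
      have h2 := congrArg (fun w => b • w) this
      simp only [hbb] at h2
      rw [hz] at h2
      exact hh (by rw [this, h2])
    · rw [hb z hz, ht', ← hb z hz, hbb]
  refine ⟨h.ext fun z => ?_, h.ext fun z => ?_, fun g hg => h.ext fun z => ?_⟩
  · simp only [mul_smul, hbt]
  · simp only [mul_smul, hbb, one_smul]
  · have hg' : ∀ z : X, g • t • z = t • g • z := fun z => by rw [← mul_smul, hg, mul_smul]
    have key : ∀ z : X, (g * b * g⁻¹) • z = z ∨ (g * b * g⁻¹) • z = t • z := by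
      intro z
      simp only [mul_smul]
      by_cases hz : b • g⁻¹ • z = g⁻¹ • z
      · left; rw [hz, smul_inv_smul]
      · right; rw [hb _ hz, hg', smul_inv_smul]
    have hct : ∀ z : X, (g * b * g⁻¹) • t • z = t • (g * b * g⁻¹) • z := by
      have hgi : ∀ z : X, g⁻¹ • t • z = t • g⁻¹ • z := by
        intro z
        rw [inv_smul_eq_iff, hg', smul_inv_smul]
      intro z
      simp only [mul_smul, hgi, hbt, hg']
    generalize g * b * g⁻¹ = c at *
    simp only [mul_smul]
    have kb : ∀ z : X, b • z = z ∨ b • z = t • z := fun z => by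
      by_cases hz : b • z = z
      · exact Or.inl hz
      · exact Or.inr (hb z hz)
    rcases key z with h1 | h1 <;> rcases kb z with h2 | h2
    · rw [h1, h2, h1]
    · rw [h1, h2, hct, h1]
    · rw [h1, h2, hbt, h2, h1]
    · rw [h1, h2, hct, h1, hbt, h2]

theorem claim2 (h : SRGood A X) {t r : A} (ht : t * t = 1) (hr : r ∈ srC t) (x : X)
    (hx : t • x ≠ x) : (r * r) • x = x := by
  haveI := h.t2
  -- `r` maps `x` into `{x, t x}`
  have key : ∀ x : X, t • x ≠ x → r • x = x ∨ r • x = t • x := by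
    intro x hx
    by_contra hcon
    push Not at hcon
    obtain ⟨P, Q, hP, hQ, hxP, hxQ, hd⟩ := t2_separation hcon.1
    obtain ⟨P', Q', hP', hQ', hxP', hxQ', hd'⟩ := t2_separation hcon.2
    obtain ⟨b, hbx, hb⟩ := h.p2 t ht x hx (Q ∩ (fun z => t • z) ⁻¹' Q')
      (hQ.inter (hQ'.preimage (h.cont t))) ⟨hxQ, hxQ'⟩
    have hbU : b ∈ srU t := h.memU ht fun z hz => (hb z hz).1
    have hrb := hr b hbU
    have hm : b • r • x ≠ r • x := by
      rw [← mul_smul, ← hrb, mul_smul]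
      intro hh
      exact hbx (smul_left_cancel r hh)
    rcases (hb _ hm).2 with h1 | h1
    · exact Set.disjoint_left.1 hd hxP h1.1
    · have := h1.2
      simp only [Set.mem_preimage, invol ht] at this
      exact Set.disjoint_left.1 hd' hxP' this
  have htx : t • t • x ≠ t • x := fun hh => hx (smul_left_cancel t hh)
  rw [mul_smul]
  rcases key x hx with h1 | h1
  · rw [h1, h1]
  · rw [h1]
    rcases key _ htx with h2 | h2
    · rw [← h1] at h2
      have := smul_left_cancel r h2
      rw [h1] at this
      exact absurd this hx
    · rw [h2, invol ht]

theorem claim3 (h : SRGood A X) {t : A} (ht : t * t = 1) (a : A) :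
    a ∈ srW t ↔ ∀ x : X, a • x ≠ x → t • x ≠ x := by
  constructor
  · intro ha x hx htx
    obtain ⟨N, hN, hxN, hNU, hd⟩ := h.sep a x hx _ (h.isOpen_fix t ht) htx
    obtain ⟨g, hg, z, hz, hgz⟩ := h.f3 x N hN hxN
    have hgC : g ∈ srC t := by
      intro s hs
      apply h.ext
      intro w
      simp only [mul_smul]
      have hsf : ∀ w ∈ N, s • w = w := fun w hw => by
        by_contra hh
        exact h.claim1 ht hs w hh (hNU hw)
      by_cases hw : w ∈ N
      · rw [hsf w hw, hsf _ (maps_of_supp hg hw)]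
      · rw [fix_of_supp hg hw, fix_of_supp hg]
        intro hh
        have := hsf _ hh
        have := smul_left_cancel s this
        exact hw (this ▸ hh)
    have hc := congrArg (fun a : A => a • z) (ha g hgC)
    simp only [mul_smul] at hc
    rw [fix_of_supp hg (hd z hz), fix_of_supp hg (hd z hz)] at hc
    apply hgz
    rw [mul_smul]
    exact smul_left_cancel a hc
  · intro ha r hr
    apply h.ext
    intro z
    rw [mul_smul a, mul_smul (r * r) a]
    by_cases hz : t • z = z
    · have e1 : a • z = z := by
        by_contra hh
        exact ha z hh hz
      rw [e1]
      by_contra hh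
      have h1 := h.claim2 ht hr _ (ha _ hh)
      have h2 := smul_left_cancel _ h1
      rw [h2] at hh
      exact hh e1
    · rw [h.claim2 ht hr z hz]
      by_cases hz' : a • z = z
      · rw [hz', h.claim2 ht hr z hz]
      · rw [h.claim2 ht hr (a • z)]
        apply ha
        intro hh
        exact hz' (smul_left_cancel a hh)

end SRGood

section TwoSpaces

variable {A X B Y : Type*} [Group A] [MulAction A X] [TopologicalSpace X]
  [Group B] [MulAction B Y] [TopologicalSpace Y]

theorem sr_subset (h : SRGood A X) (k : SRGood B Y) (Φ : A ≃* B) {t : A} (ht : t * t = 1) {a : A}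
    (hs : ∀ x : X, a • x ≠ x → t • x ≠ x) (y : Y) (hy : Φ a • y ≠ y) : Φ t • y ≠ y := by
  have h1 := (h.claim3 ht a).2 hs
  rw [srW_map Φ] at h1
  exact (k.claim3 (by rw [← map_mul, ht, map_one]) _).1 h1 y hy

theorem sr_disj (h : SRGood A X) (k : SRGood B Y) (Φ : A ≃* B) {t s : A} (ht : t * t = 1)
    (hs : s * s = 1) (hd : ∀ x : X, t • x ≠ x → s • x = x) (y : Y) (hy : Φ t • y ≠ y) :
    Φ s • y = y := by
  by_contra hcon
  obtain ⟨b, hb, hby, hb'⟩ := k.p1 y _ ((k.isOpen_mv (Φ t)).inter (k.isOpen_mv (Φ s)))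
    ⟨hy, hcon⟩
  have hid : ∀ a : A, Φ.symm (Φ a) = a := Φ.symm_apply_apply
  have h1 : ∀ x : X, Φ.symm b • x ≠ x → t • x ≠ x := by
    intro x hx
    have := sr_subset k h Φ.symm (t := Φ t) (by rw [← map_mul, ht, map_one])
      (fun z hz => (hb' z hz).1) x hx
    rwa [hid] at this
  have h2 : ∀ x : X, Φ.symm b • x ≠ x → s • x ≠ x := by
    intro x hx
    have := sr_subset k h Φ.symm (t := Φ s) (by rw [← map_mul, hs, map_one])
      (fun z hz => (hb' z hz).2) x hx
    rwa [hid] at this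
  have h3 : Φ.symm b = 1 := h.faith _ fun x => by
    by_contra hh
    exact h2 x hh (hd x (h1 x hh))
  rw [MulEquiv.symm_apply_eq, map_one] at h3
  rw [h3, one_smul] at hby
  exact hby rfl

theorem sr_exists (h : SRGood A X) (k : SRGood B Y) (Φ : A ≃* B) (x : X) :
    ∃ y : Y, ∀ t : A, t * t = 1 → (t • x ≠ x ↔ Φ t • y ≠ y) := by
  classical
  haveI := h.t2
  haveI := k.t2
  -- finite intersections
  have fin : ∀ s : Finset {t : A // t * t = 1 ∧ t • x ≠ x},
      (⋂ i ∈ s, {y : Y | Φ i.1 • y ≠ y}).Nonempty := by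
    intro s
    obtain ⟨u, hu, hux, hu'⟩ := h.p1 x (⋂ i ∈ s, {x : X | i.1 • x ≠ x})
      (isOpen_biInter_finset fun i _ => h.isOpen_mv _)
      (by simp only [Set.mem_iInter]; exact fun i _ => i.2.2)
    have hne : Φ u ≠ 1 := by
      intro hh
      rw [map_eq_one_iff Φ Φ.injective] at hh
      rw [hh, one_smul] at hux
      exact hux rfl
    have : ∃ y : Y, Φ u • y ≠ y := by
      by_contra hcon
      push Not at hcon
      exact hne (k.faith _ hcon)
    obtain ⟨y, hy⟩ := this
    refine ⟨y, ?_⟩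
    simp only [Set.mem_iInter]
    intro i hi
    refine sr_subset h k Φ i.2.1 (fun z hz => ?_) y hy
    have := hu' z hz
    simp only [Set.mem_iInter] at this
    exact this i hi
  have hK : ∀ i : {t : A // t * t = 1 ∧ t • x ≠ x}, IsCompact {y : Y | Φ i.1 • y ≠ y} :=
    fun i => k.p3 _ (by rw [← map_mul, i.2.1, map_one])
  obtain ⟨t0, ht0, ht0x, -⟩ := h.p1 x Set.univ isOpen_univ trivial
  have hne : ({y : Y | Φ t0 • y ≠ y} ∩ ⋂ i : {t : A // t * t = 1 ∧ t • x ≠ x},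
      {y : Y | Φ i.1 • y ≠ y}).Nonempty := by
    refine (hK ⟨t0, ht0, ht0x⟩).inter_iInter_nonempty _ (fun i => (hK i).isClosed) fun s => ?_
    obtain ⟨y, hy⟩ := fin (insert ⟨t0, ht0, ht0x⟩ s)
    simp only [Set.mem_iInter] at hy
    refine ⟨y, hy _ (Finset.mem_insert_self _ _), ?_⟩
    simp only [Set.mem_iInter]
    exact fun i hi => hy i (Finset.mem_insert_of_mem hi)
  obtain ⟨y, -, hy⟩ := hne
  simp only [Set.mem_iInter] at hy
  refine ⟨y, fun t ht => ⟨fun htx => hy ⟨t, ht, htx⟩, fun hty htx => ?_⟩⟩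
  obtain ⟨u, hu, hux, hu'⟩ := h.p1 x _ (h.isOpen_fix t ht) htx
  exact hty (sr_disj h k Φ hu ht (fun z hz => hu' z hz) y (hy ⟨u, hu, hux⟩))

theorem SRGood.eq_of (h : SRGood A X) {x x' : X}
    (hh : ∀ t : A, t * t = 1 → (t • x ≠ x ↔ t • x' ≠ x')) : x = x' := by
  by_contra hne
  haveI := h.t2
  obtain ⟨u, hu, hux, hu'⟩ := h.p1 x {x'}ᶜ isOpen_compl_singleton hne
  exact hu' x' ((hh u hu).1 hux) rfl

theorem sr_recon (h : SRGood A X) (k : SRGood B Y) (Φ : A ≃* B) :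
    ∃ φ : X ≃ₜ Y, ∀ (a : A) (x : X), φ (a • x) = Φ a • φ x := by
  choose f hf using sr_exists h k Φ
  choose g hg using sr_exists k h Φ.symm
  have hinv : ∀ t : A, t * t = 1 → Φ t * Φ t = 1 := fun t ht => by rw [← map_mul, ht, map_one]
  have hinv' : ∀ t : B, t * t = 1 → Φ.symm t * Φ.symm t = 1 :=
    fun t ht => by rw [← map_mul, ht, map_one]
  have hgf : ∀ x, g (f x) = x := fun x => h.eq_of fun t ht => by
    have := hg (f x) (Φ t) (hinv t ht)
    rw [Φ.symm_apply_apply] at this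
    rw [← this, ← hf x t ht]
  have hfg : ∀ y, f (g y) = y := fun y => k.eq_of fun t ht => by
    have := hf (g y) (Φ.symm t) (hinv' t ht)
    rw [Φ.apply_symm_apply] at this
    rw [← this, ← hg y t ht]
  have cf : Continuous f := by
    rw [continuous_iff_continuousAt]
    intro x U hU
    obtain ⟨W, hWU, hW, hxW⟩ := mem_nhds_iff.1 hU
    obtain ⟨u, hu, hux, hu'⟩ := k.p1 (f x) W hW hxW
    have e : Φ (Φ.symm u) = u := Φ.apply_symm_apply u
    refine Filter.mem_map.2 (Filter.mem_of_superset
      ((h.isOpen_mv (Φ.symm u)).mem_nhds ?_) fun z hz => ?_)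
    · have := (hf x (Φ.symm u) (hinv' u hu)).2 (by rwa [e])
      exact this
    · have := (hf z (Φ.symm u) (hinv' u hu)).1 hz
      rw [e] at this
      exact hWU (hu' _ this)
  have cg : Continuous g := by
    rw [continuous_iff_continuousAt]
    intro y U hU
    obtain ⟨W, hWU, hW, hxW⟩ := mem_nhds_iff.1 hU
    obtain ⟨u, hu, hux, hu'⟩ := h.p1 (g y) W hW hxW
    have e : Φ.symm (Φ u) = u := Φ.symm_apply_apply u
    refine Filter.mem_map.2 (Filter.mem_of_superset
      ((k.isOpen_mv (Φ u)).mem_nhds ?_) fun z hz => ?_)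
    · have := (hg y (Φ u) (hinv u hu)).2 (by rwa [e])
      exact this
    · have := (hg z (Φ u) (hinv u hu)).1 hz
      rw [e] at this
      exact hWU (hu' _ this)
  refine ⟨⟨⟨f, g, hgf, hfg⟩, cf, cg⟩, fun a x => ?_⟩
  change f (a • x) = Φ a • f x
  refine k.eq_of fun t ht => ?_
  have e : Φ (Φ.symm t) = t := Φ.apply_symm_apply t
  have h1 := hf (a • x) (Φ.symm t) (hinv' t ht)
  rw [e] at h1
  rw [← h1]
  have h2 := hf x (a⁻¹ * Φ.symm t * a) (by
    have := hinv' t ht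
    calc a⁻¹ * Φ.symm t * a * (a⁻¹ * Φ.symm t * a) = a⁻¹ * (Φ.symm t * Φ.symm t) * a := by group
      _ = 1 := by rw [this]; group)
  simp only [map_mul, map_inv, e, mul_smul] at h2
  rw [ne_eq, ne_eq, inv_smul_eq_iff, inv_smul_eq_iff] at h2
  exact h2

end TwoSpaces

/-! ## Basic facts on paths -/

section PathBasics

variable {V E : Type*} {G : DGraph V E}

theorem FinPath.ext' {μ ν : FinPath G} (h1 : μ.src = ν.src) (h2 : μ.edges = ν.edges) : μ = ν := by
  cases μ; cases ν; simp at h1 h2; subst h1; subst h2; rfl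

theorem FinPath.rng_nil {μ : FinPath G} (h : μ.edges.length = 0) : μ.rng = μ.src := by
  have : μ.edges = [] := List.length_eq_zero_iff.1 h
  simp [FinPath.rng, this]

theorem FinPath.rng_last {μ : FinPath G} {n : ℕ} (h : μ.edges.length = n + 1) {e : E}
    (he : μ.edges[n]? = some e) : μ.rng = G.r e := by
  have : μ.edges.getLast? = some e := by
    rw [List.getLast?_eq_getElem?, h]; simpa using he
  simp [FinPath.rng, this]

theorem FinPath.edge_zero {μ : FinPath G} {e : E} (h : μ.edges[0]? = some e) : G.s e = μ.src := by
  apply μ.src_eq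
  rw [List.head?_eq_getElem?, h]; simp

theorem FinPath.edge_succ {μ : FinPath G} {n : ℕ} {e f : E} (h : μ.edges[n]? = some e)
    (h' : μ.edges[n + 1]? = some f) : G.r e = G.s f := by
  have := List.isChain_iff_getElem.1 μ.chain
  rw [List.getElem?_eq_some_iff] at h h'
  obtain ⟨h1, rfl⟩ := h
  obtain ⟨h2, rfl⟩ := h'
  exact this n h2

theorem BPath.edge_zero {p : BPath G} {e : E} (h : p.edgeAt 0 = some e) : G.s e = p.src := by
  rcases p with p | x
  · exact FinPath.edge_zero h
  · simp only [BPath.edgeAt, Option.some.injEq] at h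
    subst h; rfl

theorem BPath.edge_succ {p : BPath G} {n : ℕ} {e f : E} (h : p.edgeAt n = some e)
    (h' : p.edgeAt (n + 1) = some f) : G.r e = G.s f := by
  rcases p with p | x
  · exact FinPath.edge_succ h h'
  · simp only [BPath.edgeAt, Option.some.injEq] at h h'
    subst h; subst h'; exact x.chain n

theorem BPath.ext' {p q : BPath G} (h1 : p.src = q.src) (h2 : ∀ n, p.edgeAt n = q.edgeAt n) :
    p = q := by
  rcases p with ⟨p, hp⟩ | x <;> rcases q with ⟨q, hq⟩ | y
  · have : p = q := FinPath.ext' h1 (List.ext_getElem? h2)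
    subst this; rfl
  · have := h2 p.edges.length
    simp [BPath.edgeAt] at this
  · have := h2 q.edges.length
    simp [BPath.edgeAt] at this
  · have : x.edges = y.edges := funext fun n => by
      have := h2 n
      simpa [BPath.edgeAt] using this
    cases x; cases y; simp at this; subst this; rfl

def bfin (ν : FinPath G) (h : Singular G ν.rng) : BPath G := Sum.inl ⟨ν, h⟩

def binf (x : InfPath G) : BPath G := Sum.inr x

theorem BPath.cases' (p : BPath G) : (∃ ν h, p = bfin ν h) ∨ ∃ x, p = binf x := by
  rcases p with ⟨ν, h⟩ | x
  · exact Or.inl ⟨ν, h, rfl⟩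
  · exact Or.inr ⟨x, rfl⟩

theorem bfin_edge (ν : FinPath G) (h : Singular G ν.rng) (n : ℕ) :
    (bfin ν h).edgeAt n = ν.edges[n]? := rfl

theorem binf_edge (x : InfPath G) (n : ℕ) : (binf x).edgeAt n = some (x.edges n) := rfl

theorem bfin_src (ν : FinPath G) (h : Singular G ν.rng) : (bfin ν h).src = ν.src := rfl

theorem binf_src (x : InfPath G) : (binf x).src = G.s (x.edges 0) := rfl

theorem IsPrefixOf.next {μ : FinPath G} {p : BPath G} (h : IsPrefixOf μ p) {e : E}
    (he : p.edgeAt μ.edges.length = some e) : G.s e = μ.rng := by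
  rcases hn : μ.edges.length with _ | n
  · rw [FinPath.rng_nil hn, h.1]
    rw [hn] at he
    exact BPath.edge_zero he
  · have h1 := h.2 n (by omega)
    have h2 : μ.edges[n]? = some (μ.edges[n]'(by omega)) := List.getElem?_eq_getElem _
    rw [FinPath.rng_last hn h2]
    rw [hn] at he
    exact (BPath.edge_succ (h1.trans h2) he).symm

theorem IsPrefixOf.self {ν : FinPath G} (h : Singular G ν.rng) :
    IsPrefixOf ν (bfin ν h) := ⟨rfl, fun _ _ => rfl⟩

/-- concatenation of finite paths -/
def FinPath.app (μ κ : FinPath G) (h : μ.rng = κ.src) : FinPath G where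
  src := μ.src
  edges := μ.edges ++ κ.edges
  src_eq := by
    intro e he
    rw [List.head?_append] at he
    rcases hm : μ.edges.head? with _ | f
    · rw [hm] at he
      have h1 : μ.edges = [] := List.head?_eq_none_iff.1 hm
      have h2 := FinPath.rng_nil (μ := μ) (by simp [h1])
      rw [← h2, h]
      exact κ.src_eq e (by simpa using he)
    · rw [hm] at he
      apply μ.src_eq
      rw [hm]; simpa using he
  chain := by
    refine List.IsChain.append μ.chain κ.chain ?_
    intro x hx y hy
    have h2 := κ.src_eq y hy
    rw [h2, ← h]
    simp only [Option.mem_def] at hx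
    simp [FinPath.rng, hx]

theorem FinPath.app_rng (μ κ : FinPath G) (h : μ.rng = κ.src) : (μ.app κ h).rng = κ.rng := by
  unfold FinPath.app FinPath.rng
  simp only
  rw [List.getLast?_append]
  rcases hk : κ.edges.getLast? with _ | f
  · simpa [FinPath.rng] using h
  · simp

/-- the path consisting of a single edge -/
def edgePath (G : DGraph V E) (e : E) : FinPath G :=
  ⟨G.s e, [e], by simp, List.IsChain.singleton e⟩

theorem edgePath_src (e : E) : (edgePath G e).src = G.s e := rfl

theorem edgePath_length (e : E) : (edgePath G e).edges.length = 1 := rfl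

theorem edgePath_get (e : E) : (edgePath G e).edges[0]? = some e := rfl

theorem edgePath_rng (e : E) : (edgePath G e).rng = G.r e := by
  simp [edgePath, FinPath.rng]

/-- initial segment of a finite path -/
def FinPath.tk (μ : FinPath G) (n : ℕ) : FinPath G where
  src := μ.src
  edges := μ.edges.take n
  src_eq := by
    intro e he
    apply μ.src_eq
    rw [List.head?_take] at he
    split_ifs at he
    · simp at he
    · exact he
  chain := μ.chain.take n

/-- terminal segment of a finite path -/
def FinPath.dr (μ : FinPath G) (n : ℕ) : FinPath G where
  src := (μ.tk n).rng
  edges := μ.edges.drop n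
  src_eq := by
    intro e he
    rw [List.head?_drop] at he
    rcases n with _ | n
    · rw [FinPath.rng_nil (by simp [FinPath.tk])]
      exact FinPath.edge_zero (μ := μ) he
    · have hl : n + 1 < μ.edges.length := by
        by_contra hh
        rw [List.getElem?_eq_none (by omega)] at he
        simp at he
      have h2 : μ.edges[n]? = some (μ.edges[n]'(by omega)) := List.getElem?_eq_getElem _
      rw [FinPath.rng_last (n := n) (e := μ.edges[n]'(by omega))
        (by simp [FinPath.tk]; omega) (by simp [FinPath.tk])]
      exact (FinPath.edge_succ h2 he).symm
  chain := μ.chain.drop n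

theorem FinPath.dr_src (μ : FinPath G) (n : ℕ) : (μ.tk n).rng = (μ.dr n).src := rfl

theorem FinPath.tk_dr (μ : FinPath G) (n : ℕ) : (μ.tk n).app (μ.dr n) (μ.dr_src n) = μ :=
  FinPath.ext' rfl (List.take_append_drop n μ.edges)

theorem FinPath.dr_rng (μ : FinPath G) (n : ℕ) : (μ.dr n).rng = μ.rng := by
  conv_rhs => rw [← μ.tk_dr n, FinPath.app_rng]

/-- tails of infinite paths -/
def InfPath.dr (x : InfPath G) (n : ℕ) : InfPath G :=
  ⟨fun i => x.edges (n + i), fun i => x.chain (n + i)⟩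

/-- segment of an infinite path -/
def InfPath.seg (x : InfPath G) (a n : ℕ) : FinPath G where
  src := G.s (x.edges a)
  edges := (List.range n).map fun i => x.edges (a + i)
  src_eq := by
    intro e he
    rw [List.head?_eq_getElem?] at he
    rcases n with _ | n
    · simp at he
    · simp at he; subst he; rfl
  chain := by
    refine List.isChain_iff_getElem.2 ?_
    intro i hi
    simp only [List.getElem_map, List.getElem_range]
    exact x.chain (a + i)

theorem InfPath.seg_length (x : InfPath G) (a n : ℕ) : (x.seg a n).edges.length = n := by
  simp [InfPath.seg]

theorem InfPath.seg_get (x : InfPath G) (a n i : ℕ) (hi : i < n) :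
    (x.seg a n).edges[i]? = some (x.edges (a + i)) := by
  simp [InfPath.seg, hi]

theorem InfPath.seg_rng (x : InfPath G) (a n : ℕ) : (x.seg a n).rng = G.s (x.edges (a + n)) := by
  rcases n with _ | n
  · rw [FinPath.rng_nil (by simp [InfPath.seg])]; rfl
  · rw [FinPath.rng_last (x.seg_length a (n + 1)) (x.seg_get a (n + 1) n (by omega))]
    exact x.chain (a + n)

theorem InfPath.seg_isPre (x : InfPath G) (n : ℕ) : IsPrefixOf (x.seg 0 n) (binf x) := by
  refine ⟨rfl, fun i hi => ?_⟩
  rw [x.seg_length] at hi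
  rw [x.seg_get 0 n i hi, binf_edge, zero_add]

/-- concatenation of a finite path and a boundary path -/
def BPath.app (μ : FinPath G) : (z : BPath G) → (h : μ.rng = z.src) → BPath G
  | Sum.inl κ, h => Sum.inl ⟨μ.app κ.1 h, (FinPath.app_rng μ κ.1 h).symm ▸ κ.2⟩
  | Sum.inr x, h => Sum.inr
    { edges := fun n => if hn : n < μ.edges.length then μ.edges[n] else x.edges (n - μ.edges.length)
      chain := by
        intro n
        by_cases h1 : n + 1 < μ.edges.length
        · simp only [h1, dif_pos, show n < μ.edges.length by omega]
          exact FinPath.edge_succ (List.getElem?_eq_getElem _) (List.getElem?_eq_getElem _)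
        · by_cases h2 : n + 1 = μ.edges.length
          · simp only [h1, show n < μ.edges.length by omega, dif_pos, dif_neg, not_false_eq_true]
            rw [h2]
            have := FinPath.rng_last h2.symm (List.getElem?_eq_getElem (by omega))
            rw [← this, h]
            simp [BPath.src, InfPath.src]
          · simp only [h1, show ¬ n < μ.edges.length by omega, dif_neg, not_false_eq_true]
            rw [show n + 1 - μ.edges.length = (n - μ.edges.length) + 1 by omega]
            exact x.chain _ }

theorem BPath.app_edge_lt (μ : FinPath G) (z : BPath G) (h : μ.rng = z.src) {n : ℕ}
    (hn : n < μ.edges.length) : (BPath.app μ z h).edgeAt n = μ.edges[n]? := by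
  rcases z with z | x
  · simp [BPath.app, BPath.edgeAt, FinPath.app, List.getElem?_append_left hn]
  · simp [BPath.app, BPath.edgeAt, hn]

theorem BPath.app_edge_add (μ : FinPath G) (z : BPath G) (h : μ.rng = z.src) (n : ℕ) :
    (BPath.app μ z h).edgeAt (μ.edges.length + n) = z.edgeAt n := by
  rcases z with z | x
  · change (μ.edges ++ z.1.edges)[μ.edges.length + n]? = _
    rw [List.getElem?_append_right (by omega)]
    simp [BPath.edgeAt]
  · simp [BPath.app, BPath.edgeAt]

theorem BPath.app_src (μ : FinPath G) (z : BPath G) (h : μ.rng = z.src) :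
    (BPath.app μ z h).src = μ.src := by
  rcases z with z | x
  · rfl
  · rcases hn : μ.edges.length with _ | n
    · rw [← FinPath.rng_nil hn, h]
      simp [BPath.app, BPath.src, InfPath.src, hn]
    · simp only [BPath.app, BPath.src, InfPath.src, hn]
      simp only [Nat.zero_lt_succ, dif_pos]
      exact FinPath.edge_zero (List.getElem?_eq_getElem _)

theorem BPath.app_isPre (μ : FinPath G) (z : BPath G) (h : μ.rng = z.src) :
    IsPrefixOf μ (BPath.app μ z h) :=
  ⟨(BPath.app_src μ z h).symm, fun _ hi => BPath.app_edge_lt μ z h hi⟩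

theorem IsPrefixOf.length_le {μ ν : FinPath G} {h : Singular G ν.rng}
    (hp : IsPrefixOf μ (bfin ν h)) : μ.edges.length ≤ ν.edges.length := by
  by_contra hh
  have h1 := hp.2 ν.edges.length (by omega)
  rw [bfin_edge, List.getElem?_eq_none le_rfl] at h1
  rw [List.getElem?_eq_getElem (by omega)] at h1
  simp at h1

theorem FinPath.eq_app {μ ν : FinPath G} (h1 : μ.src = ν.src) (hl : μ.edges.length ≤ ν.edges.length)
    (h2 : ∀ i, i < μ.edges.length → ν.edges[i]? = μ.edges[i]?) :
    ∃ (κ : FinPath G) (h : μ.rng = κ.src), ν = μ.app κ h := by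
  have e : ν.tk μ.edges.length = μ := by
    refine FinPath.ext' h1.symm ?_
    apply List.ext_getElem?
    intro i
    simp only [FinPath.tk, List.getElem?_take]
    split_ifs with hi
    · exact h2 i hi
    · rw [List.getElem?_eq_none (by omega)]
  have e2 := ν.tk_dr μ.edges.length
  have e3 : μ.rng = (ν.dr μ.edges.length).src := by
    change _ = (ν.tk μ.edges.length).rng
    rw [e]
  refine ⟨ν.dr μ.edges.length, e3, ?_⟩
  apply FinPath.ext'
  · exact h1.symm
  · have := congrArg FinPath.edges e2
    simp only [FinPath.app] at this ⊢
    rw [e] at this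
    exact this.symm

/-- Every boundary path with initial segment `μ` is of the form `μz`. -/
theorem IsPrefixOf.exists_app {μ : FinPath G} {p : BPath G} (hp : IsPrefixOf μ p) :
    ∃ (z : BPath G) (h : μ.rng = z.src), p = BPath.app μ z h := by
  rcases p.cases' with ⟨ν, hν, rfl⟩ | ⟨x, rfl⟩
  · obtain ⟨κ, h, rfl⟩ := FinPath.eq_app hp.1 hp.length_le hp.2
    refine ⟨bfin κ (by rwa [FinPath.app_rng] at hν), h, rfl⟩
  · have h1 : μ.rng = (binf (x.dr μ.edges.length)).src :=
      (hp.next (e := x.edges μ.edges.length) rfl).symm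
    refine ⟨binf (x.dr μ.edges.length), h1, BPath.ext' ?_ fun n => ?_⟩
    · rw [BPath.app_src, hp.1]
    · by_cases hn : n < μ.edges.length
      · rw [BPath.app_edge_lt _ _ _ hn, hp.2 n hn]
      · obtain ⟨k, rfl⟩ := Nat.exists_eq_add_of_le (not_lt.1 hn)
        rw [BPath.app_edge_add]; rfl

theorem IsPrefixOf.comparable {μ ν : FinPath G} {p : BPath G} (h1 : IsPrefixOf μ p)
    (h2 : IsPrefixOf ν p) (hl : μ.edges.length ≤ ν.edges.length) :
    ∃ (κ : FinPath G) (h : μ.rng = κ.src), ν = μ.app κ h :=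
  FinPath.eq_app (h1.1.trans h2.1.symm) hl fun i hi => by
    rw [← h1.2 i hi, h2.2 i (by omega)]

theorem IsPrefixOf.eq_of_length {μ ν : FinPath G} {p : BPath G} (h1 : IsPrefixOf μ p)
    (h2 : IsPrefixOf ν p) (hl : μ.edges.length = ν.edges.length) : μ = ν := by
  refine FinPath.ext' (h1.1.trans h2.1.symm) (List.ext_getElem? fun i => ?_)
  by_cases hi : i < μ.edges.length
  · rw [← h1.2 i hi, h2.2 i (by omega)]
  · rw [List.getElem?_eq_none (by omega), List.getElem?_eq_none (by omega)]

theorem FinPath.app_length (μ κ : FinPath G) (h : μ.rng = κ.src) :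
    (μ.app κ h).edges.length = μ.edges.length + κ.edges.length := by simp [FinPath.app]

theorem FinPath.app_get_add (μ κ : FinPath G) (h : μ.rng = κ.src) (i : ℕ) :
    (μ.app κ h).edges[μ.edges.length + i]? = κ.edges[i]? := by
  change (μ.edges ++ κ.edges)[μ.edges.length + i]? = _
  rw [List.getElem?_append_right (by omega)]
  simp

theorem FinPath.app_get_lt (μ κ : FinPath G) (h : μ.rng = κ.src) {i : ℕ}
    (hi : i < μ.edges.length) :
    (μ.app κ h).edges[i]? = μ.edges[i]? := by simp [FinPath.app, List.getElem?_append_left hi]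

/-- `z` starts with `κ` iff `μz` starts with `μκ`. -/
theorem app_prefix_app {μ κ : FinPath G} {z : BPath G} (h : μ.rng = κ.src) (h' : μ.rng = z.src) :
    IsPrefixOf (μ.app κ h) (BPath.app μ z h') ↔ IsPrefixOf κ z := by
  constructor
  · intro hp
    refine ⟨h.symm.trans h', fun i hi => ?_⟩
    have := hp.2 (μ.edges.length + i) (by rw [FinPath.app_length]; omega)
    rwa [BPath.app_edge_add, FinPath.app_get_add] at this
  · intro hp
    refine ⟨(BPath.app_src μ z h').symm, fun i hi => ?_⟩
    by_cases hn : i < μ.edges.length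
    · rw [BPath.app_edge_lt _ _ _ hn, FinPath.app_get_lt _ _ _ hn]
    · obtain ⟨k, rfl⟩ := Nat.exists_eq_add_of_le (not_lt.1 hn)
      rw [BPath.app_edge_add, FinPath.app_get_add]
      rw [FinPath.app_length] at hi
      exact hp.2 k (by omega)

theorem IsPrefixOf.of_app {μ κ : FinPath G} {p : BPath G} (h : μ.rng = κ.src)
    (hp : IsPrefixOf (μ.app κ h) p) : IsPrefixOf μ p := by
  refine ⟨hp.1, fun i hi => ?_⟩
  rw [hp.2 i (by rw [FinPath.app_length]; omega), FinPath.app_get_lt _ _ _ hi]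

theorem IsPrefixOf.app_edge {μ : FinPath G} {p : BPath G} (hp : IsPrefixOf μ p) {e : E}
    (h : μ.rng = (edgePath G e).src) :
    IsPrefixOf (μ.app (edgePath G e) h) p ↔ p.edgeAt μ.edges.length = some e := by
  have h0 := FinPath.app_get_add μ (edgePath G e) h 0
  rw [edgePath_get, add_zero] at h0
  constructor
  · intro h1
    rw [h1.2 μ.edges.length (by rw [FinPath.app_length, edgePath_length]; omega), h0]
  · intro h1
    refine ⟨hp.1, fun i hi => ?_⟩
    by_cases hn : i < μ.edges.length
    · rw [FinPath.app_get_lt _ _ _ hn, hp.2 i hn]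
    · have : i = μ.edges.length := by
        rw [FinPath.app_length, edgePath_length] at hi; omega
      subst this
      rw [h1, h0]

/-! ### shifting -/

theorem IsShiftedBy.unique {l m : FinPath G} {p q q' : BPath G} (h : IsShiftedBy l m p q)
    (h' : IsShiftedBy l m p q') : q = q' := by
  refine BPath.ext' (h.1.1.symm.trans h'.1.1) fun n => ?_
  by_cases hn : n < m.edges.length
  · rw [h.1.2 n hn, h'.1.2 n hn]
  · obtain ⟨k, rfl⟩ := Nat.exists_eq_add_of_le (not_lt.1 hn)
    rw [← h.2, ← h'.2]

theorem isShiftedBy_app {l m : FinPath G} {z : BPath G} (h : l.rng = z.src) (h' : m.rng = z.src) :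
    IsShiftedBy l m (BPath.app l z h) (BPath.app m z h') :=
  ⟨BPath.app_isPre _ _ _, fun n => by rw [BPath.app_edge_add, BPath.app_edge_add]⟩

theorem IsShiftedBy.exists {l m : FinPath G} {p : BPath G} (hp : IsPrefixOf l p)
    (hr : m.rng = l.rng) : ∃ q, IsShiftedBy l m p q := by
  obtain ⟨z, h, rfl⟩ := hp.exists_app
  exact ⟨_, isShiftedBy_app h (hr.trans h)⟩

theorem IsShiftedBy.symm {l m : FinPath G} {p q : BPath G} (hp : IsPrefixOf l p)
    (h : IsShiftedBy l m p q) : IsShiftedBy m l q p := ⟨hp, fun n => (h.2 n).symm⟩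

theorem IsShiftedBy.mem_ZMinus {l m : FinPath G} {p q : BPath G} {F : Set E}
    (h : IsShiftedBy l m p q) (hp : p ∈ ZMinus l F) : q ∈ ZMinus m F := by
  refine ⟨h.1, fun e he => ?_⟩
  have := h.2 0
  simp only [add_zero] at this
  rw [← this]
  exact hp.2 e he

open Classical in
/-- The prefix exchange `λz ↦ μz`. -/
noncomputable def shiftB (l m : FinPath G) (p : BPath G) : BPath G :=
  if h : ∃ q, IsShiftedBy l m p q then h.choose else p

theorem shiftB_spec {l m : FinPath G} {p : BPath G} (hp : IsPrefixOf l p) (hr : m.rng = l.rng) :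
    IsShiftedBy l m p (shiftB l m p) := by
  have h := IsShiftedBy.exists hp hr
  unfold shiftB
  rw [dif_pos h]
  exact h.choose_spec

theorem shiftB_app {l m : FinPath G} {z : BPath G} (h : l.rng = z.src) (h' : m.rng = z.src) :
    shiftB l m (BPath.app l z h) = BPath.app m z h' :=
  (shiftB_spec (BPath.app_isPre _ _ _) (h'.trans h.symm)).unique (isShiftedBy_app h h')

theorem shiftB_shiftB {l m : FinPath G} {p : BPath G} (hp : IsPrefixOf l p) (hr : m.rng = l.rng) :
    shiftB m l (shiftB l m p) = p := by
  have h1 := shiftB_spec hp hr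
  exact (shiftB_spec h1.1 hr.symm).unique (h1.symm hp)

end PathBasics

/-! ## Topology of the boundary path space -/

section PathTop

variable {V E : Type*} {G : DGraph V E}

theorem mem_ZSet {μ : FinPath G} {p : BPath G} : p ∈ ZSet μ ↔ IsPrefixOf μ p := Iff.rfl

theorem mem_ZMinus {μ : FinPath G} {F : Set E} {p : BPath G} :
    p ∈ ZMinus μ F ↔ IsPrefixOf μ p ∧ ∀ e ∈ F, p.edgeAt μ.edges.length ≠ some e := Iff.rfl

theorem ZMinus_subset (μ : FinPath G) (F : Set E) : ZMinus μ F ⊆ ZSet μ := fun _ h => h.1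

theorem ZMinus_empty (μ : FinPath G) : ZMinus μ ∅ = ZSet μ := by
  ext p; simp [mem_ZMinus, mem_ZSet]

theorem isOpen_ZMinus {μ : FinPath G} {F : Set E} (hF : F.Finite) (h : ∀ e ∈ F, G.s e = μ.rng) :
    IsOpen (ZMinus μ F) := TopologicalSpace.isOpen_generateFrom_of_mem ⟨μ, F, hF, h, rfl⟩

theorem isOpen_ZSet (μ : FinPath G) : IsOpen (ZSet μ) := by
  rw [← ZMinus_empty]
  exact isOpen_ZMinus Set.finite_empty (by simp)

theorem isClopen_ZSet (μ : FinPath G) : IsClopen (ZSet μ) := by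
  refine ⟨⟨?_⟩, isOpen_ZSet μ⟩
  rw [isOpen_iff_forall_mem_open]
  intro p hp
  by_cases hs : μ.src = p.src
  · have : ∃ i, i < μ.edges.length ∧ p.edgeAt i ≠ μ.edges[i]? := by
      by_contra hh
      push Not at hh
      exact hp ⟨hs, hh⟩
    classical
    have h1 := Nat.find_spec this
    have h2 := fun {m} => Nat.find_min this (m := m)
    generalize Nat.find this = i at h1 h2
    obtain ⟨hi, hne⟩ := h1
    have hlen : (μ.tk i).edges.length = i := by simp [FinPath.tk]; omega
    have hget : μ.edges[i]? = some (μ.edges[i]) := List.getElem?_eq_getElem hi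
    refine ⟨ZMinus (μ.tk i) {μ.edges[i]}, ?_, isOpen_ZMinus (Set.finite_singleton _) ?_, ?_, ?_⟩
    · intro q hq hq'
      apply hq.2 _ rfl
      rw [hlen, hq'.2 i hi, hget]
    · intro e he
      rw [Set.mem_singleton_iff] at he
      subst he
      rw [FinPath.dr_src]
      apply FinPath.edge_zero
      simp only [FinPath.dr, List.getElem?_drop, add_zero]
      exact hget
    · refine ⟨hs, fun j hj => ?_⟩
      rw [hlen] at hj
      have := h2 hj
      push Not at this
      rw [this (by omega)]
      simp [FinPath.tk, hj]
    · intro e he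
      rw [Set.mem_singleton_iff] at he
      subst he
      rw [hlen, ← hget]
      exact hne
  · refine ⟨ZSet (trivialPath G p.src), ?_, isOpen_ZSet _, ?_⟩
    · intro q hq hq'
      exact hs (hq'.1.trans hq.1.symm)
    · exact ⟨rfl, fun i hi => by simp [trivialPath] at hi⟩

theorem ZMinus_eq {μ : FinPath G} {F : Set E} :
    ZMinus μ F = ZSet μ \ ⋃ e ∈ F, {p | IsPrefixOf μ p ∧ p.edgeAt μ.edges.length = some e} := by
  ext p
  simp only [mem_ZMinus, Set.mem_diff, mem_ZSet, Set.mem_iUnion, not_exists]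
  constructor
  · rintro ⟨h1, h2⟩
    exact ⟨h1, fun e he h => h2 e he h.2⟩
  · rintro ⟨h1, h2⟩
    exact ⟨h1, fun e he h => h2 e he ⟨h1, h⟩⟩

theorem edgeSet_eq {μ : FinPath G} {e : E} (h : μ.rng = (edgePath G e).src) :
    {p : BPath G | IsPrefixOf μ p ∧ p.edgeAt μ.edges.length = some e} =
      ZSet (μ.app (edgePath G e) h) := by
  ext p
  constructor
  · rintro ⟨h1, h2⟩
    exact (h1.app_edge h).2 h2
  · intro hp
    have h1 := hp.of_app h
    exact ⟨h1, (h1.app_edge h).1 hp⟩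

theorem isClopen_edgeSet (μ : FinPath G) (e : E) :
    IsClopen {p : BPath G | IsPrefixOf μ p ∧ p.edgeAt μ.edges.length = some e} := by
  by_cases h : μ.rng = (edgePath G e).src
  · rw [edgeSet_eq h]; exact isClopen_ZSet _
  · convert isClopen_empty
    ext p
    simp only [Set.mem_empty_iff_false, iff_false]
    rintro ⟨h1, h2⟩
    exact h (h1.next h2).symm

theorem isClopen_ZMinus (μ : FinPath G) {F : Set E} (hF : F.Finite) : IsClopen (ZMinus μ F) := by
  rw [ZMinus_eq]
  exact (isClopen_ZSet μ).diff (hF.isClopen_biUnion fun e _ => isClopen_edgeSet μ e)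

theorem continuous_to_BPath {T : Type*} [TopologicalSpace T] {f : T → BPath G}
    (h : ∀ ν, IsClopen (f ⁻¹' ZSet ν)) : Continuous f := by
  refine continuous_generateFrom_iff.2 ?_
  rintro S ⟨μ, F, hF, hs, rfl⟩
  rw [ZMinus_eq, Set.preimage_diff, Set.preimage_iUnion₂]
  refine ((h μ).diff (hF.isClopen_biUnion fun e he => ?_)).isOpen
  rw [edgeSet_eq (hs e he).symm]
  exact h _

instance : T2Space (BPath G) := by
  refine ⟨fun p q hpq => ?_⟩
  have : ∃ ν, ¬ (p ∈ ZSet ν ↔ q ∈ ZSet ν) := by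
    by_contra hcon
    push Not at hcon
    apply hpq
    have h0 : ∀ p : BPath G, p ∈ ZSet (trivialPath G p.src) :=
      fun p => ⟨rfl, fun i hi => by simp [trivialPath] at hi⟩
    have hsrc : p.src = q.src := ((hcon _).1 (h0 p)).1
    -- edges agree
    have key : ∀ n, ∃ ν : FinPath G, p ∈ ZSet ν ∧ q ∈ ZSet ν ∧
        (ν.edges.length = n ∨ (ν.edges.length ≤ n ∧ p.edgeAt ν.edges.length = none ∧
          q.edgeAt ν.edges.length = none)) := by
      intro n
      induction n with
      | zero =>
        exact ⟨trivialPath G p.src, h0 p, (hcon _).1 (h0 p), Or.inl (by simp [trivialPath])⟩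
      | succ n ih =>
        obtain ⟨ν, h1, h2, h3⟩ := ih
        rcases h3 with h3 | h3
        · rcases hp : p.edgeAt ν.edges.length with _ | e
          · rcases hq : q.edgeAt ν.edges.length with _ | e
            · exact ⟨ν, h1, h2, Or.inr ⟨by omega, hp, hq⟩⟩
            · have hr : ν.rng = (edgePath G e).src := (h2.next hq).symm
              have h5 : q ∈ ZSet (ν.app _ hr) := (IsPrefixOf.app_edge h2 hr).2 hq
              have h6 := (IsPrefixOf.app_edge h1 hr).1 ((hcon _).2 h5)
              rw [hp] at h6
              simp at h6
          · have hr : ν.rng = (edgePath G e).src := (h1.next hp).symm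
            have h5 : p ∈ ZSet (ν.app _ hr) := (IsPrefixOf.app_edge h1 hr).2 hp
            exact ⟨ν.app _ hr, h5, (hcon _).1 h5,
              Or.inl (by rw [FinPath.app_length, edgePath_length, h3])⟩
        · exact ⟨ν, h1, h2, Or.inr ⟨by omega, h3.2⟩⟩
    have none_le : ∀ (p : BPath G) m n, m ≤ n → p.edgeAt m = none → p.edgeAt n = none := by
      intro p m n hmn hm
      rcases p.cases' with ⟨ν, h, rfl⟩ | ⟨x, rfl⟩
      · rw [bfin_edge, List.getElem?_eq_none_iff] at *
        omega
      · rw [binf_edge] at hm; simp at hm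
    refine BPath.ext' hsrc fun n => ?_
    obtain ⟨ν, h1, h2, h3⟩ := key (n + 1)
    rcases h3 with h3 | ⟨h3, h4, h5⟩
    · rw [h1.2 n (by omega), h2.2 n (by omega)]
    · by_cases hn : n < ν.edges.length
      · rw [h1.2 n (by omega), h2.2 n (by omega)]
      · rw [none_le p _ n (by omega) h4, none_le q _ n (by omega) h5]
  obtain ⟨ν, hν⟩ := this
  by_cases hp : p ∈ ZSet ν
  · have hq : q ∉ ZSet ν := fun hq => hν ⟨fun _ => hq, fun _ => hp⟩
    exact ⟨_, _, isOpen_ZSet ν, (isClopen_ZSet ν).compl.isOpen, hp, hq, disjoint_compl_right⟩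
  · have hq : q ∈ ZSet ν := by
      by_contra hq
      exact hν ⟨fun h => absurd h hp, fun h => absurd h hq⟩
    exact ⟨_, _, (isClopen_ZSet ν).compl.isOpen, isOpen_ZSet ν, hp, hq, disjoint_compl_left⟩

theorem InfPath.seg_le {x : InfPath G} {m n : ℕ} (h : m ≤ n) :
    ZSet (x.seg 0 n) ⊆ ZSet (x.seg 0 m) := by
  intro p hp
  refine ⟨hp.1, fun i hi => ?_⟩
  rw [x.seg_length] at hi
  rw [hp.2 i (by rw [x.seg_length]; omega), x.seg_get _ _ _ hi, x.seg_get _ _ _ (by omega)]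

/-- neighbourhood basis at an infinite path -/
theorem basis_inf (x : InfPath G) {U : Set (BPath G)} (hU : IsOpen U) (hx : binf x ∈ U) :
    ∃ n, ZSet (x.seg 0 n) ⊆ U := by
  induction hU with
  | basic S hS =>
    obtain ⟨μ, F, hF, hs, rfl⟩ := hS
    refine ⟨μ.edges.length + 1, fun p hp => ⟨⟨?_, fun i hi => ?_⟩, fun e he => ?_⟩⟩
    · rw [hx.1.1, ← hp.1]; rfl
    · rw [← hx.1.2 i hi, hp.2 i (by rw [x.seg_length]; omega), x.seg_get _ _ _ (by omega),
        binf_edge, zero_add]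
    · have := hx.2 e he
      rwa [hp.2 _ (by rw [x.seg_length]; omega), x.seg_get _ _ _ (by omega), zero_add]
  | univ => exact ⟨0, Set.subset_univ _⟩
  | inter S T _ _ ih1 ih2 =>
    obtain ⟨n, hn⟩ := ih1 hx.1
    obtain ⟨m, hm⟩ := ih2 hx.2
    exact ⟨max n m, Set.subset_inter ((InfPath.seg_le (le_max_left _ _)).trans hn)
      ((InfPath.seg_le (le_max_right _ _)).trans hm)⟩
  | sUnion S _ ih =>
    obtain ⟨T, hT, hxT⟩ := hx
    obtain ⟨n, hn⟩ := ih T hT hxT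
    exact ⟨n, hn.trans (Set.subset_sUnion_of_mem hT)⟩

theorem ZMinus_anti (μ : FinPath G) {F F' : Set E} (h : F ⊆ F') : ZMinus μ F' ⊆ ZMinus μ F :=
  fun _ hp => ⟨hp.1, fun e he => hp.2 e (h he)⟩

/-- neighbourhood basis at a finite path -/
theorem basis_fin (ν : FinPath G) (hν : Singular G ν.rng) {U : Set (BPath G)} (hU : IsOpen U)
    (hx : bfin ν hν ∈ U) :
    ∃ F : Set E, F.Finite ∧ ZMinus ν F ⊆ U := by
  induction hU with
  | basic S hS =>
    obtain ⟨μ, F, hF, hs, rfl⟩ := hS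
    refine ⟨F, hF, fun p hp => ?_⟩
    have hl := hx.1.length_le
    have hpre : IsPrefixOf μ p := by
      refine ⟨hx.1.1.trans hp.1.1, fun i hi => ?_⟩
      rw [hp.1.2 i (by omega), ← hx.1.2 i hi, bfin_edge]
    refine ⟨hpre, ?_⟩
    rcases hl.eq_or_lt with h | h
    · rw [h]; exact hp.2
    · intro e he
      rw [hp.1.2 _ h]
      exact hx.2 e he
  | univ => exact ⟨∅, Set.finite_empty, Set.subset_univ _⟩
  | inter S T _ _ ih1 ih2 =>
    obtain ⟨n, hn', hn⟩ := ih1 hx.1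
    obtain ⟨m, hm', hm⟩ := ih2 hx.2
    exact ⟨n ∪ m, hn'.union hm', Set.subset_inter
      ((ZMinus_anti ν Set.subset_union_left).trans hn)
      ((ZMinus_anti ν Set.subset_union_right).trans hm)⟩
  | sUnion S _ ih =>
    obtain ⟨T, hT, hxT⟩ := hx
    obtain ⟨n, hn', hn⟩ := ih T hT hxT
    exact ⟨n, hn', hn.trans (Set.subset_sUnion_of_mem hT)⟩

theorem tk_isPre {ν : FinPath G} {p : BPath G} (hp : IsPrefixOf ν p) (n : ℕ) :
    IsPrefixOf (ν.tk n) p := by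
  refine ⟨hp.1, fun i hi => ?_⟩
  simp only [FinPath.tk, List.length_take] at hi
  rw [hp.2 i (by omega)]
  simp only [FinPath.tk, List.getElem?_take]
  rw [if_pos (by omega)]

theorem isCompact_ZSet (hs : ∀ v, ¬ IsSink G v) (μ : FinPath G) : IsCompact (ZSet μ) := by
  rw [isCompact_iff_ultrafilter_le_nhds]
  intro u hu
  have huμ : ZSet μ ∈ u := hu (Filter.mem_principal_self _)
  suffices h : ∃ p : BPath G, (u : Filter (BPath G)) ≤ nhds p by
    obtain ⟨p, hp⟩ := h
    refine ⟨p, ?_, hp⟩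
    by_contra hh
    have h1 : (ZSet μ)ᶜ ∈ u := hp ((isClopen_ZSet μ).compl.isOpen.mem_nhds hh)
    exact (Ultrafilter.compl_mem_iff_notMem.1 h1) huμ
  have uniq : ∀ ν ν' : FinPath G, ZSet ν ∈ u → ZSet ν' ∈ u → ∃ p, IsPrefixOf ν p ∧ IsPrefixOf ν' p :=
    fun ν ν' h h' => by
      obtain ⟨p, hp⟩ := u.nonempty_of_mem (Filter.inter_mem h h')
      exact ⟨p, hp⟩
  by_cases hQ : ∀ n, ∃ ν : FinPath G, n ≤ ν.edges.length ∧ ZSet ν ∈ u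
  · choose ν hl hν using hQ
    have hget : ∀ n m i, i < n → i < m → (ν n).edges[i]? = (ν m).edges[i]? := by
      intro n m i hn hm
      obtain ⟨p, h1, h2⟩ := uniq _ _ (hν n) (hν m)
      have := hl n
      have := hl m
      rw [← h1.2 i (by omega), h2.2 i (by omega)]
    let f : ℕ → E := fun n => (ν (n + 1)).edges[n]'(by have := hl (n + 1); omega)
    have hf : ∀ n m, n < m → (ν m).edges[n]? = some (f n) := by
      intro n m hnm
      rw [hget m (n + 1) n hnm (by omega)]
      exact List.getElem?_eq_getElem _
    let x : InfPath G := ⟨f, fun i =>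
      FinPath.edge_succ (hf i (i + 2) (by omega)) (hf (i + 1) (i + 2) (by omega))⟩
    refine ⟨binf x, fun U hU => ?_⟩
    obtain ⟨W, hWU, hW, hxW⟩ := mem_nhds_iff.1 hU
    obtain ⟨n, hn⟩ := basis_inf x hW hxW
    refine Filter.mem_of_superset (hν (n + 1)) (fun p hp => hWU (hn ?_))
    have := hl (n + 1)
    refine ⟨?_, fun i hi => ?_⟩
    · rw [← hp.1]
      exact FinPath.edge_zero (hf 0 (n + 1) (by omega))
    · rw [x.seg_length] at hi
      rw [hp.2 i (by omega), x.seg_get _ _ _ hi, hf i _ (by omega), zero_add]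
  · push Not at hQ
    obtain ⟨N, hN⟩ := hQ
    -- a longest path
    obtain ⟨ν, hν, hmax⟩ : ∃ ν : FinPath G, ZSet ν ∈ u ∧
        ∀ ν' : FinPath G, ZSet ν' ∈ u → ν'.edges.length ≤ ν.edges.length := by
      classical
      let P : ℕ → Prop := fun n => ∃ ν : FinPath G, ν.edges.length = n ∧ ZSet ν ∈ u
      have hb : ∀ n, P n → n ≤ N := by
        rintro n ⟨ν, rfl, h⟩
        by_contra hh
        exact hN ν (by omega) h
      have hP : P (Nat.findGreatest P N) :=
        Nat.findGreatest_spec (hb _ ⟨μ, rfl, huμ⟩) ⟨μ, rfl, huμ⟩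
      obtain ⟨ν, h1, h2⟩ := hP
      refine ⟨ν, h2, fun ν' h' => ?_⟩
      rw [h1]
      exact Nat.le_findGreatest (hb _ ⟨ν', rfl, h'⟩) ⟨ν', rfl, h'⟩
    have hedge : ∀ e, {p : BPath G | IsPrefixOf ν p ∧ p.edgeAt ν.edges.length = some e} ∉ u := by
      intro e he
      by_cases h : ν.rng = (edgePath G e).src
      · rw [edgeSet_eq h] at he
        have := hmax _ he
        rw [FinPath.app_length, edgePath_length] at this
        omega
      · obtain ⟨p, h1, h2⟩ := u.nonempty_of_mem he
        exact h (h1.next h2).symm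
    have hZM : ∀ F : Set E, F.Finite → ZMinus ν F ∈ u := by
      intro F hF
      rw [ZMinus_eq]
      refine Filter.inter_mem hν ?_
      refine Ultrafilter.compl_mem_iff_notMem.2 fun hh => ?_
      rw [Ultrafilter.finite_biUnion_mem_iff hF] at hh
      obtain ⟨e, -, he⟩ := hh
      exact hedge e he
    have hsing : Singular G ν.rng := by
      right
      intro hfin
      obtain ⟨p, h1, h2⟩ := u.nonempty_of_mem (hZM _ hfin)
      rcases he : p.edgeAt ν.edges.length with _ | e
      · rcases p.cases' with ⟨κ, hκ, rfl⟩ | ⟨x, rfl⟩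
        · have : κ = ν := by
            rw [bfin_edge, List.getElem?_eq_none_iff] at he
            exact ((IsPrefixOf.self hκ).eq_of_length h1 (le_antisymm he h1.length_le))
          subst this
          rcases hκ with hκ | hκ
          · exact hs _ hκ
          · exact hκ hfin
        · rw [binf_edge] at he; simp at he
      · exact h2 e (h1.next he) he
    refine ⟨bfin ν hsing, fun U hU => ?_⟩
    obtain ⟨W, hWU, hW, hxW⟩ := mem_nhds_iff.1 hU
    obtain ⟨F, hF, hn⟩ := basis_fin ν hsing hW hxW
    exact Filter.mem_of_superset (hZM F hF) (hn.trans hWU)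

end PathTop

/-! ## Prefix exchanges -/

section Swaps

variable {V E : Type*} {G : DGraph V E}

theorem isClopen_shift {l m : FinPath G} (hr : m.rng = l.rng) (ν : FinPath G) :
    IsClopen {p : BPath G | IsPrefixOf l p ∧ IsPrefixOf ν (shiftB l m p)} := by
  by_cases hl : m.edges.length ≤ ν.edges.length
  · by_cases hex : ∃ (κ : FinPath G) (h : m.rng = κ.src), ν = m.app κ h
    · obtain ⟨κ, h, rfl⟩ := hex
      have h' : l.rng = κ.src := hr.symm.trans h
      convert isClopen_ZSet (l.app κ h') using 1
      ext p
      constructor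
      · rintro ⟨h1, h2⟩
        obtain ⟨z, hz, rfl⟩ := h1.exists_app
        rw [shiftB_app hz (hr.trans hz), app_prefix_app] at h2
        exact (app_prefix_app h' hz).2 h2
      · intro hp
        have h1 : IsPrefixOf l p := IsPrefixOf.of_app h' hp
        refine ⟨h1, ?_⟩
        obtain ⟨z, hz, rfl⟩ := h1.exists_app
        rw [shiftB_app hz (hr.trans hz), app_prefix_app]
        exact (app_prefix_app h' hz).1 hp
    · convert isClopen_empty
      ext p
      simp only [Set.mem_empty_iff_false, iff_false]
      rintro ⟨h1, h2⟩
      exact hex ((shiftB_spec h1 hr).1.comparable h2 hl)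
  · by_cases hex : ν.src = m.src ∧ ∀ i, i < ν.edges.length → m.edges[i]? = ν.edges[i]?
    · convert isClopen_ZSet l using 1
      ext p
      refine ⟨fun h => h.1, fun h => ⟨h, ?_⟩⟩
      have h2 := (shiftB_spec h hr).1
      exact ⟨hex.1.trans h2.1, fun i hi => by rw [h2.2 i (by omega), hex.2 i hi]⟩
    · convert isClopen_empty
      ext p
      simp only [Set.mem_empty_iff_false, iff_false]
      rintro ⟨h1, h3⟩
      have h2 := (shiftB_spec h1 hr).1
      exact hex ⟨h3.1.trans h2.1.symm, fun i hi => by rw [← h2.2 i (by omega), h3.2 i hi]⟩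

open Classical in
/-- The involution exchanging `Z(l∖F)` and `Z(m∖F)`. -/
noncomputable def swapFun (l m : FinPath G) (F : Set E) (p : BPath G) : BPath G :=
  if p ∈ ZMinus l F then shiftB l m p else if p ∈ ZMinus m F then shiftB m l p else p

theorem swapFun_l {l m : FinPath G} {F : Set E} {p : BPath G} (hp : p ∈ ZMinus l F) :
    swapFun l m F p = shiftB l m p := by
  unfold swapFun; rw [if_pos hp]

theorem swapFun_m {l m : FinPath G} {F : Set E} (hd : ZMinus l F ∩ ZMinus m F = ∅) {p : BPath G}
    (hp : p ∈ ZMinus m F) : swapFun l m F p = shiftB m l p := by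
  unfold swapFun
  rw [if_neg, if_pos hp]
  intro h
  have : p ∈ ZMinus l F ∩ ZMinus m F := ⟨h, hp⟩
  rw [hd] at this
  exact this

theorem swapFun_off {l m : FinPath G} {F : Set E} {p : BPath G} (hp : p ∉ ZMinus l F)
    (hp' : p ∉ ZMinus m F) : swapFun l m F p = p := by
  unfold swapFun; rw [if_neg hp, if_neg hp']

theorem shiftB_mem {l m : FinPath G} {F : Set E} (hr : m.rng = l.rng) {p : BPath G}
    (hp : p ∈ ZMinus l F) : shiftB l m p ∈ ZMinus m F :=
  (shiftB_spec hp.1 hr).mem_ZMinus hp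

theorem swapFun_swapFun {l m : FinPath G} {F : Set E} (hr : m.rng = l.rng)
    (hd : ZMinus l F ∩ ZMinus m F = ∅) (p : BPath G) : swapFun l m F (swapFun l m F p) = p := by
  by_cases h1 : p ∈ ZMinus l F
  · rw [swapFun_l h1, swapFun_m hd (shiftB_mem hr h1), shiftB_shiftB h1.1 hr]
  · by_cases h2 : p ∈ ZMinus m F
    · rw [swapFun_m hd h2, swapFun_l (shiftB_mem hr.symm h2), shiftB_shiftB h2.1 hr.symm]
    · rw [swapFun_off h1 h2, swapFun_off h1 h2]

theorem continuous_swapFun {l m : FinPath G} {F : Set E} (hF : F.Finite) (hr : m.rng = l.rng)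
    (hd : ZMinus l F ∩ ZMinus m F = ∅) : Continuous (swapFun l m F) := by
  apply continuous_to_BPath
  intro ν
  have e : swapFun l m F ⁻¹' ZSet ν =
      ((ZMinus l F ∩ {p : BPath G | IsPrefixOf l p ∧ IsPrefixOf ν (shiftB l m p)}) ∪
      (ZMinus m F ∩ {p : BPath G | IsPrefixOf m p ∧ IsPrefixOf ν (shiftB m l p)})) ∪
      ((ZMinus l F)ᶜ ∩ (ZMinus m F)ᶜ ∩ ZSet ν) := by
    ext p
    by_cases h1 : p ∈ ZMinus l F
    · have h2 : p ∉ ZMinus m F := fun h2 => by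
        have : p ∈ ZMinus l F ∩ ZMinus m F := ⟨h1, h2⟩
        rw [hd] at this
        exact this
      have h3 : IsPrefixOf l p := h1.1
      simp [swapFun_l h1, h1, h2, h3, mem_ZSet]
    · by_cases h2 : p ∈ ZMinus m F
      · have h3 : IsPrefixOf m p := h2.1
        simp [swapFun_m hd h2, h1, h2, h3, mem_ZSet]
      · simp [swapFun_off h1 h2, h1, h2]
  rw [e]
  have c1 := isClopen_ZMinus l hF
  have c2 := isClopen_ZMinus m hF
  exact ((c1.inter (isClopen_shift hr ν)).union (c2.inter (isClopen_shift hr.symm ν))).union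
    ((c1.compl.inter c2.compl).inter (isClopen_ZSet ν))

/-- The involution exchanging `Z(l∖F)` and `Z(m∖F)`, as a homeomorphism. -/
noncomputable def swapH (l m : FinPath G) (F : Set E) (hF : F.Finite) (hr : m.rng = l.rng)
    (hd : ZMinus l F ∩ ZMinus m F = ∅) : BPath G ≃ₜ BPath G where
  toFun := swapFun l m F
  invFun := swapFun l m F
  left_inv := swapFun_swapFun hr hd
  right_inv := swapFun_swapFun hr hd
  continuous_toFun := continuous_swapFun hF hr hd
  continuous_invFun := continuous_swapFun hF hr hd

theorem swapH_apply (l m : FinPath G) (F : Set E) (hF : F.Finite) (hr : m.rng = l.rng)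
    (hd : ZMinus l F ∩ ZMinus m F = ∅) (p : BPath G) :
    swapH l m F hF hr hd p = swapFun l m F p := rfl

theorem swapH_inFull (l m : FinPath G) (F : Set E) (hF : F.Finite) (hr : m.rng = l.rng)
    (hd : ZMinus l F ∩ ZMinus m F = ∅) (hpr : F ⊂ {e : E | G.s e = m.rng}) :
    InFullGroup G (swapH l m F hF hr hd) := by
  have hd' : ZMinus m F ∩ ZMinus l F = ∅ := by rw [Set.inter_comm]; exact hd
  refine ⟨2, ![m, l], ![l, m], fun _ => F, ?_, fun _ => hF, ?_, ?_, ?_, ?_, ?_, ?_⟩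
  · intro i
    fin_cases i
    · exact hr
    · exact hr.symm
  · intro i
    fin_cases i
    · exact hpr
    · change F ⊂ {e : E | G.s e = l.rng}
      rw [← hr]; exact hpr
  · intro i j hij
    fin_cases i <;> fin_cases j
    · exact absurd rfl hij
    · exact hd
    · exact hd'
    · exact absurd rfl hij
  · intro i j hij
    fin_cases i <;> fin_cases j
    · exact absurd rfl hij
    · exact hd'
    · exact hd
    · exact absurd rfl hij
  · ext p
    simp only [Set.mem_iUnion, Fin.exists_fin_two]
    exact Or.comm
  · intro i
    fin_cases i
    · intro p hp
      replace hp : p ∈ ZMinus l F := hp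
      change IsShiftedBy l m p (swapFun l m F p)
      rw [swapFun_l hp]
      exact shiftB_spec hp.1 hr
    · intro p hp
      replace hp : p ∈ ZMinus m F := hp
      change IsShiftedBy m l p (swapFun l m F p)
      rw [swapFun_m hd hp]
      exact shiftB_spec hp.1 hr.symm
  · intro p hp
    simp only [Set.mem_iUnion, Fin.exists_fin_two, not_or] at hp
    exact swapFun_off hp.1 hp.2

/-- A convenient form: swaps as involutions in the full group. -/
theorem exists_path_swap (hs : ∀ v, ¬ IsSink G v) {l m : FinPath G} {F : Set E} (hF : F.Finite)
    (hr : m.rng = l.rng) (hd : ZMinus l F ∩ ZMinus m F = ∅)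
    (hFi : F = ∅ ∨ InfEmitter G m.rng) (hFs : ∀ e ∈ F, G.s e = m.rng) :
    ∃ g : BPath G ≃ₜ BPath G, InFullGroup G g ∧ (∀ p, g (g p) = p) ∧
      (∀ p ∈ ZMinus l F, IsShiftedBy l m p (g p)) ∧
      (∀ p ∈ ZMinus m F, IsShiftedBy m l p (g p)) ∧
      (∀ p, p ∉ ZMinus l F → p ∉ ZMinus m F → g p = p) := by
  refine ⟨swapH l m F hF hr hd, swapH_inFull l m F hF hr hd ?_, swapFun_swapFun hr hd,
    fun p hp => ?_, fun p hp => ?_, fun p h1 h2 => swapFun_off h1 h2⟩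
  · refine ⟨hFs, fun hsub => ?_⟩
    rcases hFi with rfl | hFi
    · apply hs m.rng
      intro e he
      exact hsub he
    · exact hFi (hF.subset hsub)
  · rw [swapH_apply, swapFun_l hp]; exact shiftB_spec hp.1 hr
  · rw [swapH_apply, swapFun_m hd hp]; exact shiftB_spec hp.1 hr.symm

/-! ### Every point is moved by small swaps -/

/-- If `x` revisits a vertex then (K) provides a return path off `x`. -/
theorem exists_off_of_revisit (hK : CondK G) (x : InfPath G) {a b : ℕ} (hab : a < b)
    (h : G.s (x.edges a) = G.s (x.edges b)) :
    ∃ c : FinPath G, c.src = G.s (x.edges a) ∧ c.rng = G.s (x.edges a) ∧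
      ¬ ∀ i, i < c.edges.length → c.edges[i]? = some (x.edges (a + i)) := by
  classical
  have hex : ∃ d, G.s (x.edges a) = G.s (x.edges (a + (d + 1))) :=
    ⟨b - a - 1, by rw [h]; congr 2; omega⟩
  have h1 := Nat.find_spec hex
  have h2 := fun {m} => Nat.find_min hex (m := m)
  generalize Nat.find hex = d at h1 h2
  have hret : (x.seg a (d + 1)).IsReturnPath := by
    refine ⟨⟨?_, ?_⟩, ?_⟩
    · intro hh
      have := x.seg_length a (d + 1)
      rw [hh] at this
      simp at this
    · rw [x.seg_rng, ← h1]; rfl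
    · intro i hi
      rw [x.seg_length] at hi
      rw [x.seg_rng, ← h1]
      have h3 : (x.seg a (d + 1)).edges.get ⟨i, by rw [x.seg_length]; omega⟩ = x.edges (a + i) := by
        simp [InfPath.seg]
      rw [h3, x.chain]
      intro hh
      exact h2 (m := i) (by omega) hh.symm
  rcases hK (G.s (x.edges a)) with hn | ⟨μ, ν, hne, hμ, hν, hμs, hνs⟩
  · exact absurd ⟨_, hret, rfl⟩ hn
  · by_contra hcon
    push Not at hcon
    have e1 := hcon μ hμs (hμ.1.2.trans hμs)
    have e2 := hcon ν hνs (hν.1.2.trans hνs)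
    -- comparable return paths are equal
    have key : ∀ μ ν : FinPath G, μ.IsReturnPath → ν.IsReturnPath →
        μ.src = G.s (x.edges a) → ν.src = G.s (x.edges a) →
        (∀ i, i < μ.edges.length → μ.edges[i]? = some (x.edges (a + i))) →
        (∀ i, i < ν.edges.length → ν.edges[i]? = some (x.edges (a + i))) →
        ¬ μ.edges.length < ν.edges.length := by
      intro μ ν hμ hν hμs hνs e1 e2 hlt
      have hpos : μ.edges.length ≠ 0 := fun h0 => hμ.1.1 (List.length_eq_zero_iff.1 h0)
      obtain ⟨k, hk⟩ := Nat.exists_eq_succ_of_ne_zero hpos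
      have h3 := hν.2 k (by omega)
      apply h3
      have h4 : ν.edges.get ⟨k, by omega⟩ = x.edges (a + k) := by
        have := e2 k (by omega)
        rw [List.getElem?_eq_getElem (by omega), Option.some.injEq] at this
        simpa using this
      rw [h4, ← FinPath.rng_last hk (e1 k (by omega)), hμ.1.2, hν.1.2, hμs, hνs]
    have l1 := key μ ν hμ hν hμs hνs e1 e2
    have l2 := key ν μ hν hμ hνs hμs e2 e1
    apply hne
    refine FinPath.ext' (hμs.trans hνs.symm) (List.ext_getElem? fun i => ?_)
    by_cases hi : i < μ.edges.length
    · rw [e1 i hi, e2 i (by omega)]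
    · rw [List.getElem?_eq_none (by omega), List.getElem?_eq_none (by omega)]

theorem exists_off (hK : CondK G) (hW : CondW G) (x : InfPath G) (n : ℕ) :
    ∃ (a m : ℕ) (c : FinPath G), n ≤ a ∧ a ≤ m ∧ c.src = G.s (x.edges a) ∧
      c.rng = G.s (x.edges m) ∧
      ¬ ∀ i, i < c.edges.length → c.edges[i]? = some (x.edges (a + i)) := by
  by_cases hw : Wandering (x.dr n)
  · obtain ⟨k, μ, ν, hne, hμs, hνs, hμr, hνr⟩ := hW _ hw
    have hsrc : (x.dr n).src = G.s (x.edges n) := rfl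
    have hrr : G.r ((x.dr n).edges k) = G.s (x.edges (n + k + 1)) := x.chain (n + k)
    rw [hsrc] at hμs hνs
    rw [hrr] at hμr hνr
    by_cases e1 : ∀ i, i < μ.edges.length → μ.edges[i]? = some (x.edges (n + i))
    · by_cases e2 : ∀ i, i < ν.edges.length → ν.edges[i]? = some (x.edges (n + i))
      · have eq : ∀ μ : FinPath G, μ.src = G.s (x.edges n) →
            (∀ i, i < μ.edges.length → μ.edges[i]? = some (x.edges (n + i))) →
            μ = x.seg n μ.edges.length := by
          intro μ hμ e
          refine FinPath.ext' hμ (List.ext_getElem? fun i => ?_)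
          by_cases hi : i < μ.edges.length
          · rw [e i hi, x.seg_get _ _ _ hi]
          · rw [List.getElem?_eq_none (by omega),
              List.getElem?_eq_none (by rw [x.seg_length]; omega)]
        have q1 := eq μ hμs e1
        have q2 := eq ν hνs e2
        have hl : μ.edges.length ≠ ν.edges.length := fun hh => hne (by rw [q1, q2, hh])
        rw [q1, x.seg_rng] at hμr
        rw [q2, x.seg_rng] at hνr
        rcases lt_or_gt_of_ne hl with hlt | hlt
        · obtain ⟨c, h1, h2, h3⟩ := exists_off_of_revisit hK x (a := n + μ.edges.length)
            (b := n + ν.edges.length) (by omega) (hμr.trans hνr.symm)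
          exact ⟨_, _, c, by omega, le_rfl, h1, h2, h3⟩
        · obtain ⟨c, h1, h2, h3⟩ := exists_off_of_revisit hK x (a := n + ν.edges.length)
            (b := n + μ.edges.length) (by omega) (hνr.trans hμr.symm)
          exact ⟨_, _, c, by omega, le_rfl, h1, h2, h3⟩
      · exact ⟨n, n + k + 1, ν, le_rfl, by omega, hνs, hνr, e2⟩
    · exact ⟨n, n + k + 1, μ, le_rfl, by omega, hμs, hμr, e1⟩
  · unfold Wandering at hw
    push Not at hw
    obtain ⟨v, hv⟩ := hw
    obtain ⟨a, ha⟩ := hv.nonempty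
    obtain ⟨b, hb, hab⟩ := hv.exists_gt a
    obtain ⟨c, h1, h2, h3⟩ := exists_off_of_revisit hK x (a := n + a) (b := n + b) (by omega)
      (Eq.trans (b := v) ha (Eq.symm hb))
    exact ⟨_, _, c, by omega, le_rfl, h1, h2, h3⟩

/-- (S1): every point is moved by an involution of the full group with small support. -/
theorem swap_at (hs : ∀ v, ¬ IsSink G v) (hK : CondK G) (hW : CondW G) (hI : CondInf G)
    (p : BPath G) (U : Set (BPath G)) (hU : IsOpen U) (hp : p ∈ U) :
    ∃ g : BPath G ≃ₜ BPath G, InFullGroup G g ∧ (∀ z, g (g z) = z) ∧ g p ≠ p ∧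
      ∀ z, g z ≠ z → z ∈ U := by
  -- it suffices to find the two cylinder sets
  suffices h : ∃ (l m : FinPath G) (F : Set E), F.Finite ∧ m.rng = l.rng ∧
      ZMinus l F ∩ ZMinus m F = ∅ ∧ (F = ∅ ∨ InfEmitter G m.rng) ∧ (∀ e ∈ F, G.s e = m.rng) ∧
      p ∈ ZMinus l F ∧ ZMinus l F ⊆ U ∧ ZMinus m F ⊆ U by
    obtain ⟨l, m, F, hF, hr, hd, hFi, hFs, hpl, hlU, hmU⟩ := h
    obtain ⟨g, hg, hgg, hgl, hgm, hgo⟩ := exists_path_swap hs hF hr hd hFi hFs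
    refine ⟨g, hg, hgg, fun hh => ?_, fun z hz => ?_⟩
    · have h1 := (hgl p hpl).mem_ZMinus hpl
      rw [hh] at h1
      have : p ∈ ZMinus l F ∩ ZMinus m F := ⟨hpl, h1⟩
      rw [hd] at this
      exact this
    · by_contra hzU
      exact hz (hgo z (fun h => hzU (hlU h)) (fun h => hzU (hmU h)))
  rcases p.cases' with ⟨ν, hν, rfl⟩ | ⟨x, rfl⟩
  · obtain ⟨F0, hF0, hFU⟩ := basis_fin ν hν hU hp
    have hinf : InfEmitter G ν.rng := hν.resolve_left (hs _)
    obtain ⟨e, ⟨he, κ, hκs, hκr⟩, heF⟩ := (hI _ hinf).exists_notMem_finite hF0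
    have hr1 : ν.rng = (edgePath G e).src := he.symm
    have hr2 : (ν.app _ hr1).rng = κ.src := by rw [FinPath.app_rng, edgePath_rng, hκs]
    have hme : ((ν.app _ hr1).app κ hr2).rng = ν.rng := by rw [FinPath.app_rng, hκr]
    let F : Set E := insert e F0 ∩ {e | G.s e = ν.rng}
    have hsub : ∀ F' : Set E, ZSet ((ν.app _ hr1).app κ hr2) ⊆
        {p : BPath G | IsPrefixOf ν p ∧ p.edgeAt ν.edges.length = some e} := by
      intro _ q hq
      rw [edgeSet_eq hr1]
      exact hq.of_app hr2
    refine ⟨ν, (ν.app _ hr1).app κ hr2, F, (hF0.insert e).subset Set.inter_subset_left, hme, ?_,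
      Or.inr (by rw [hme]; exact hinf), fun f hf => by rw [hme]; exact hf.2, ?_, ?_, ?_⟩
    · rw [Set.eq_empty_iff_forall_notMem]
      rintro q ⟨h1, h2⟩
      exact h1.2 e ⟨Set.mem_insert _ _, he⟩ (hsub F (ZMinus_subset _ _ h2)).2
    · refine ⟨IsPrefixOf.self hν, fun f _ => ?_⟩
      rw [bfin_edge, List.getElem?_eq_none le_rfl]
      simp
    · refine fun q hq => hFU ⟨hq.1, fun f hf hqf => ?_⟩
      exact hq.2 f ⟨Set.mem_insert_of_mem _ hf, hq.1.next hqf⟩ hqf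
    · intro q hq
      have h3 := hsub F (ZMinus_subset _ _ hq)
      refine hFU ⟨h3.1, fun f hf hqf => ?_⟩
      rw [h3.2, Option.some.injEq] at hqf
      exact heF (hqf ▸ hf)
  · obtain ⟨n, hn⟩ := basis_inf x hU hp
    obtain ⟨a, m, c, hna, ham, hcs, hcr, hoff⟩ := exists_off hK hW x n
    have hr1 : (x.seg 0 a).rng = c.src := by rw [x.seg_rng, hcs, zero_add]
    have hr2 : ((x.seg 0 a).app c hr1).rng = (x.seg m c.edges.length).src := by
      rw [FinPath.app_rng, hcr]; rfl
    refine ⟨x.seg 0 (m + c.edges.length), ((x.seg 0 a).app c hr1).app (x.seg m c.edges.length) hr2,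
      ∅, Set.finite_empty, ?_, ?_, Or.inl rfl, by simp, ?_, ?_, ?_⟩
    · rw [FinPath.app_rng, x.seg_rng, x.seg_rng, zero_add]
    · rw [ZMinus_empty, ZMinus_empty, Set.eq_empty_iff_forall_notMem]
      rintro q ⟨h1, h2⟩
      apply hoff
      intro i hi
      have h3 : IsPrefixOf ((x.seg 0 a).app c hr1) q := h2.of_app hr2
      have h4 := FinPath.app_get_add (x.seg 0 a) c hr1 i
      rw [x.seg_length] at h4
      rw [← h4, ← h3.2 (a + i) (by rw [FinPath.app_length, x.seg_length]; omega),
        h1.2 (a + i) (by rw [x.seg_length]; omega), x.seg_get _ _ _ (by omega), zero_add]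
    · rw [ZMinus_empty]; exact x.seg_isPre _
    · rw [ZMinus_empty]
      exact (InfPath.seg_le (by omega)).trans hn
    · rw [ZMinus_empty]
      intro q hq
      apply (InfPath.seg_le hna).trans hn
      exact (IsPrefixOf.of_app hr2 hq).of_app hr1

end Swaps

/-! ## Local properties of the full group -/

section Local

variable {V E : Type*} {G : DGraph V E}

/-- Basic neighbourhoods inside a given cylinder. -/
theorem exists_basic (hs : ∀ v, ¬ IsSink G v) {l : FinPath G} {x : BPath G} (hl : IsPrefixOf l x)
    {N : Set (BPath G)} (hN : IsOpen N) (hx : x ∈ N) :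
    ∃ (κ : FinPath G) (h : l.rng = κ.src) (F : Set E), F.Finite ∧
      (F = ∅ ∨ InfEmitter G κ.rng) ∧ (∀ e ∈ F, G.s e = κ.rng) ∧
      x ∈ ZMinus (l.app κ h) F ∧ ZMinus (l.app κ h) F ⊆ N := by
  rcases x.cases' with ⟨ν, hν, rfl⟩ | ⟨y, rfl⟩
  · obtain ⟨F, hF, hFN⟩ := basis_fin ν hν hN hx
    obtain ⟨κ, h, rfl⟩ := hl.comparable (IsPrefixOf.self hν) hl.length_le
    have hinf : InfEmitter G κ.rng := by
      have := hν.resolve_left (hs _)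
      rwa [FinPath.app_rng] at this
    refine ⟨κ, h, F ∩ {e | G.s e = κ.rng}, hF.subset Set.inter_subset_left, Or.inr hinf,
      fun e he => he.2, ⟨IsPrefixOf.self hν, fun f _ => ?_⟩, fun q hq => hFN ⟨hq.1, fun f hf hqf => ?_⟩⟩
    · rw [bfin_edge, List.getElem?_eq_none le_rfl]
      simp
    · have h3 := hq.1.next hqf
      rw [FinPath.app_rng] at h3
      exact hq.2 f ⟨hf, h3⟩ hqf
  · obtain ⟨n, hn⟩ := basis_inf y hN hx
    have hlen : l.edges.length ≤ (y.seg 0 (n + l.edges.length)).edges.length := by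
      rw [y.seg_length]; omega
    obtain ⟨κ, h, e⟩ := hl.comparable (y.seg_isPre (n + l.edges.length)) hlen
    refine ⟨κ, h, ∅, Set.finite_empty, Or.inl rfl, by simp, ?_, ?_⟩
    · rw [ZMinus_empty, ← e]
      exact y.seg_isPre _
    · rw [ZMinus_empty, ← e]
      exact (InfPath.seg_le (by omega)).trans hn

theorem IsShiftedBy.app {l m κ : FinPath G} (hl : l.rng = κ.src) (hm : m.rng = κ.src)
    {p q : BPath G} (hp : IsPrefixOf (l.app κ hl) p) (h : IsShiftedBy l m p q) :
    IsShiftedBy (l.app κ hl) (m.app κ hm) p q := by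
  obtain ⟨z, hz, rfl⟩ := (hp.of_app hl).exists_app
  have hz' : m.rng = z.src := hm.trans (hl.symm.trans hz)
  have e := h.unique (isShiftedBy_app hz hz')
  subst e
  refine ⟨(app_prefix_app hm hz').2 ((app_prefix_app hl hz).1 hp), fun n => ?_⟩
  rw [FinPath.app_length, FinPath.app_length, add_assoc, add_assoc, BPath.app_edge_add,
    BPath.app_edge_add]

/-- (S2): local restrictions of full group elements to involutions. -/
theorem restrict_at (hs : ∀ v, ¬ IsSink G v) {τ : BPath G ≃ₜ BPath G} (hτ : InFullGroup G τ)
    {x : BPath G} (hx : τ x ≠ x) {U : Set (BPath G)} (hU : IsOpen U) (hxU : x ∈ U) :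
    ∃ (a : BPath G ≃ₜ BPath G) (B : Set (BPath G)), InFullGroup G a ∧ IsOpen B ∧ x ∈ B ∧ B ⊆ U ∧
      (∀ p, a (a p) = p) ∧ (∀ z ∈ B, a z = τ z) ∧ (∀ z ∈ B, τ z ∉ B) ∧
      (∀ z, a z ≠ z → z ∈ B ∨ ∃ w ∈ B, z = τ w) := by
  obtain ⟨k, μ, lam, F, hr, hF, -, -, -, -, hsh, hoff⟩ := hτ
  have hxm : x ∈ ⋃ i, ZMinus (lam i) (F i) := by
    by_contra hc
    exact hx (hoff x hc)
  obtain ⟨i, hi⟩ := Set.mem_iUnion.1 hxm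
  obtain ⟨O1, O2, hO1, hO2, hxO1, hxO2, hdis⟩ := t2_separation hx.symm
  have hN : IsOpen (U ∩ ZMinus (lam i) (F i) ∩ (O1 ∩ τ ⁻¹' O2)) :=
    (hU.inter (isClopen_ZMinus _ (hF i)).isOpen).inter (hO1.inter (hO2.preimage τ.continuous))
  obtain ⟨κ, h, F', hF', hFi, hFs, hxF, hsub⟩ := exists_basic hs hi.1 hN ⟨⟨hxU, hi⟩, hxO1, hxO2⟩
  have hm : (μ i).rng = κ.src := (hr i).trans h
  have hshift : ∀ p ∈ ZMinus ((lam i).app κ h) F',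
      IsShiftedBy ((lam i).app κ h) ((μ i).app κ hm) p (τ p) := fun p hp =>
    (hsh i p (hsub hp).1.2).app h hm hp.1
  have himg : ∀ q ∈ ZMinus ((μ i).app κ hm) F', ∃ p ∈ ZMinus ((lam i).app κ h) F', q = τ p := by
    intro q hq
    obtain ⟨p, hp⟩ := IsShiftedBy.exists (l := (μ i).app κ hm) (m := (lam i).app κ h) hq.1
      (by rw [FinPath.app_rng, FinPath.app_rng])
    have hpm := hp.mem_ZMinus hq
    exact ⟨p, hpm, (hp.symm hq.1).unique (hshift p hpm)⟩
  have hBd : ∀ z ∈ ZMinus ((lam i).app κ h) F', τ z ∉ ZMinus ((lam i).app κ h) F' := by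
    intro z hz hz'
    exact Set.disjoint_left.1 hdis (hsub hz').2.1 (hsub hz).2.2
  obtain ⟨g, hg, hgg, hgl, hgm, hgo⟩ := exists_path_swap hs (l := (lam i).app κ h)
    (m := (μ i).app κ hm) hF' (by rw [FinPath.app_rng, FinPath.app_rng])
    (by
      rw [Set.eq_empty_iff_forall_notMem]
      rintro q ⟨h1, h2⟩
      obtain ⟨p, hp, rfl⟩ := himg q h2
      exact hBd p hp h1) (by rw [FinPath.app_rng]; exact hFi) (by rw [FinPath.app_rng]; exact hFs)
  refine ⟨g, ZMinus ((lam i).app κ h) F', hg, (isClopen_ZMinus _ hF').isOpen, hxF,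
    fun z hz => (hsub hz).1.1, hgg, fun z hz => (hgl z hz).unique (hshift z hz), hBd,
    fun z hz => ?_⟩
  by_contra hc
  push Not at hc
  refine hz (hgo z hc.1 fun hz2 => ?_)
  obtain ⟨p, hp, e⟩ := himg z hz2
  exact hc.2 p hp e

/-- Fixed point sets of involutions in the full group are open. -/
theorem isOpen_fix (hs : ∀ v, ¬ IsSink G v) (hK : CondK G) (hW : CondW G) (hI : CondInf G)
    {τ : BPath G ≃ₜ BPath G} (hτ : InFullGroup G τ) (hinv : ∀ z, τ (τ z) = z) :
    IsOpen {x | τ x = x} := by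
  obtain ⟨k, μ, lam, F, hr, hF, -, -, -, -, hsh, hoff⟩ := hτ
  rw [isOpen_iff_forall_mem_open]
  intro x hx
  replace hx : τ x = x := hx
  by_cases hxm : x ∈ ⋃ i, ZMinus (lam i) (F i)
  swap
  · refine ⟨(⋃ i, ZMinus (lam i) (F i))ᶜ, fun z hz => hoff z hz, ?_, hxm⟩
    exact (isClosed_iUnion_of_finite fun i => (isClopen_ZMinus _ (hF i)).isClosed).isOpen_compl
  obtain ⟨i, hi⟩ := Set.mem_iUnion.1 hxm
  have hxi := hsh i x hi
  rw [hx] at hxi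
  by_cases hlen : (lam i).edges.length = (μ i).edges.length
  · have e : lam i = μ i := hi.1.eq_of_length hxi.1 hlen
    refine ⟨ZMinus (lam i) (F i), fun z hz => ?_, (isClopen_ZMinus _ (hF i)).isOpen, hi⟩
    have h1 := hsh i z hz
    rw [← e] at h1
    exact h1.unique ⟨hz.1, fun _ => rfl⟩
  exfalso
  -- periodicity near `x`
  obtain ⟨a, d, hd, hper⟩ : ∃ a d : ℕ, 0 < d ∧ ∀ z, z ∈ ZMinus (lam i) (F i) →
      τ z ∈ ZMinus (lam i) (F i) → ∀ n, z.edgeAt (a + d + n) = z.edgeAt (a + n) := by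
    rcases lt_or_gt_of_ne hlen with hlt | hlt
    · obtain ⟨d, hd⟩ := Nat.exists_eq_add_of_lt hlt
      refine ⟨(lam i).edges.length, 2 * (d + 1), by omega, fun z hz hz' n => ?_⟩
      have h1 := (hsh i z hz).2
      have h2 := (hsh i _ hz').2
      rw [hinv] at h2
      have h3 := h2 (d + 1 + n)
      have h4 := h1 n
      rw [h4, show (lam i).edges.length + 2 * (d + 1) + n =
        (μ i).edges.length + (d + 1 + n) by omega, ← h3]
      congr 1; omega
    · obtain ⟨d, hd⟩ := Nat.exists_eq_add_of_lt hlt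
      refine ⟨(μ i).edges.length, 2 * (d + 1), by omega, fun z hz hz' n => ?_⟩
      have h1 := (hsh i z hz).2
      have h2 := (hsh i _ hz').2
      rw [hinv] at h2
      have h3 := h1 (d + 1 + n)
      have h4 := h2 n
      rw [← h4, show (μ i).edges.length + 2 * (d + 1) + n =
        (lam i).edges.length + (d + 1 + n) by omega, h3]
      congr 1; omega
  have hxper := hper x hi (by rw [hx]; exact hi)
  obtain ⟨y, rfl⟩ : ∃ y, x = binf y := by
    rcases x.cases' with ⟨ν, hν, rfl⟩ | h
    · exfalso
      have l1 := hi.1.length_le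
      have l2 := hxi.1.length_le
      rcases lt_or_gt_of_ne hlen with hlt | hlt
      · have h1 := hxi.2 (ν.edges.length - (μ i).edges.length)
        rw [bfin_edge, bfin_edge, List.getElem?_eq_none (i := (μ i).edges.length + _) (by omega),
          List.getElem?_eq_none_iff] at h1
        omega
      · have h1 := hxi.2 (ν.edges.length - (lam i).edges.length)
        rw [bfin_edge, bfin_edge, List.getElem?_eq_none (i := (lam i).edges.length + _) (by omega),
          eq_comm, List.getElem?_eq_none_iff] at h1
        omega
    · exact h
  have hO : IsOpen (ZMinus (lam i) (F i) ∩ τ ⁻¹' ZMinus (lam i) (F i) ∩ ZSet (y.seg 0 (a + d))) :=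
    (((isClopen_ZMinus _ (hF i)).isOpen).inter
      ((isClopen_ZMinus _ (hF i)).isOpen.preimage τ.continuous)).inter (isOpen_ZSet _)
  have hsing : ∀ z ∈ ZMinus (lam i) (F i) ∩ τ ⁻¹' ZMinus (lam i) (F i) ∩ ZSet (y.seg 0 (a + d)),
      z = binf y := by
    rintro z ⟨⟨h1, h2⟩, h3⟩
    have hz := hper z h1 h2
    have h3' : IsPrefixOf (y.seg 0 (a + d)) z := h3
    have h4 := y.seg_isPre (a + d)
    refine BPath.ext' (h3'.1.symm.trans h4.1) fun n => ?_
    induction n using Nat.strong_induction_on with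
    | _ n ih =>
      by_cases hn : n < a + d
      · rw [h3'.2 n (by rw [y.seg_length]; exact hn), h4.2 n (by rw [y.seg_length]; exact hn)]
      · obtain ⟨j, rfl⟩ := Nat.exists_eq_add_of_le (not_lt.1 hn)
        rw [hz, hxper]
        exact ih _ (by omega)
  obtain ⟨g, -, hgg, hgx, hgs⟩ := swap_at hs hK hW hI (binf y) _ hO
    ⟨⟨hi, by rw [Set.mem_preimage, hx]; exact hi⟩, y.seg_isPre _⟩
  exact hgx (hsing _ (hgs _ (by rw [hgg]; exact hgx.symm)))

theorem isCompact_supp (hs : ∀ v, ¬ IsSink G v) (hK : CondK G) (hW : CondW G) (hI : CondInf G)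
    {τ : BPath G ≃ₜ BPath G} (hτ : InFullGroup G τ) (hinv : ∀ z, τ (τ z) = z) :
    IsCompact {x | τ x ≠ x} := by
  have h1 : IsClosed {x | τ x ≠ x} := (isOpen_fix hs hK hW hI hτ hinv).isClosed_compl
  obtain ⟨k, μ, lam, F, hr, hF, -, -, -, -, hsh, hoff⟩ := hτ
  refine (isCompact_iUnion fun i => isCompact_ZSet hs (lam i)).of_isClosed_subset h1 fun x hx => ?_
  by_contra hc
  refine hx (hoff x fun hm => hc ?_)
  obtain ⟨i, hi⟩ := Set.mem_iUnion.1 hm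
  exact Set.mem_iUnion.2 ⟨i, hi.1⟩

/-- The basic commutator computation. -/
theorem comm_calc {X : Type*} {a g : X → X} {B : Set X} (ha : ∀ z, a (a z) = z)
    (hg : ∀ z, g (g z) = z) (hB : ∀ z ∈ B, a z ∉ B) (hgB : ∀ z, g z ≠ z → z ∈ B) :
    (∀ z ∈ B, a (g (a (g z))) = g z) ∧
    (∀ z, a z ∈ B → a (g (a (g z))) = a (g (a z))) ∧
    (∀ z, z ∉ B → a z ∉ B → a (g (a (g z))) = z) ∧ (∀ z ∈ B, g z ∈ B) := by
  have hoff : ∀ z, z ∉ B → g z = z := fun z hz => by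
    by_contra h
    exact hz (hgB z h)
  have hpres : ∀ z ∈ B, g z ∈ B := fun z hz => by
    by_contra h
    have := hoff _ h
    rw [hg] at this
    rw [← this] at h
    exact h hz
  refine ⟨fun z hz => ?_, fun z hz => ?_, fun z hz hz' => ?_, hpres⟩
  · rw [hoff _ (hB _ (hpres z hz)), ha]
  · rw [hoff z fun h => hB z h hz]
  · rw [hoff z hz, hoff _ hz', ha]

theorem comm_facts {X : Type*} {a g h : X → X} {B : Set X} (ha : ∀ z, a (a z) = z)
    (hg : ∀ z, g (g z) = z) (hB : ∀ z ∈ B, a z ∉ B) (hgB : ∀ z, g z ≠ z → z ∈ B)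
    (hh : ∀ z, h z = a (g (a (g z)))) :
    (∀ z, h (h z) = z) ∧ (∀ z, a (h z) = h (a z)) ∧ (∀ z ∈ B, h z = g z) ∧
    (∀ z, h z ≠ z → z ∈ B ∨ a z ∈ B) := by
  obtain ⟨h1, h2, h3, h4⟩ := comm_calc ha hg hB hgB
  simp only [← hh] at h1 h2 h3
  refine ⟨fun z => ?_, fun z => ?_, h1, fun z hz => ?_⟩
  · by_cases c1 : z ∈ B
    · rw [h1 z c1, h1 _ (h4 z c1), hg]
    · by_cases c2 : a z ∈ B
      · rw [h2 z c2, h2 _ (by rw [ha]; exact h4 _ c2), ha, hg, ha]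
      · rw [h3 z c1 c2, h3 z c1 c2]
  · by_cases c1 : z ∈ B
    · rw [h1 z c1, h2 (a z) (by rw [ha]; exact c1), ha]
    · by_cases c2 : a z ∈ B
      · rw [h2 z c2, h1 _ c2, ha]
      · rw [h3 z c1 c2, h3 (a z) c2 (by rw [ha]; exact c1)]
  · by_contra hc
    push Not at hc
    exact hz (h3 z hc.1 hc.2)

theorem inv_of_invol {X : Type*} [TopologicalSpace X] {a : X ≃ₜ X} (ha : ∀ z, a (a z) = z) :
    a⁻¹ = a := by
  apply Homeomorph.ext
  intro z
  change a.symm z = a z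
  rw [Homeomorph.symm_apply_eq, ha]

theorem comm_apply {X : Type*} [TopologicalSpace X] {a g : X ≃ₜ X} (ha : ∀ z, a (a z) = z)
    (hg : ∀ z, g (g z) = z) (z : X) : (⁅a, g⁆ : X ≃ₜ X) z = a (g (a (g z))) := by
  rw [commutatorElement_def, inv_of_invol ha, inv_of_invol hg]
  rfl

/-- Small neighbourhoods moved off themselves. -/
theorem exists_off_nhd {X : Type*} [TopologicalSpace X] [T2Space X] (a : X ≃ₜ X) {x : X}
    (hx : a x ≠ x) {U : Set X} (hU : IsOpen U) (hxU : x ∈ U) :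
    ∃ W, IsOpen W ∧ x ∈ W ∧ W ⊆ U ∧ ∀ z ∈ W, a z ∉ W := by
  obtain ⟨O1, O2, hO1, hO2, hxO1, hxO2, hdis⟩ := t2_separation hx.symm
  refine ⟨U ∩ (O1 ∩ a ⁻¹' O2), hU.inter (hO1.inter (hO2.preimage a.continuous)),
    ⟨hxU, hxO1, hxO2⟩, Set.inter_subset_left, fun z hz hz' => ?_⟩
  exact Set.disjoint_left.1 hdis hz'.2.1 hz.2.2

theorem gamma_p1 (hs : ∀ v, ¬ IsSink G v) (hK : CondK G) (hW : CondW G) (hI : CondInf G)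
    (Γ : Subgroup (BPath G ≃ₜ BPath G))
    (hΓc : ∀ α β : BPath G ≃ₜ BPath G, InFullGroup G α → InFullGroup G β → ⁅α, β⁆ ∈ Γ)
    (x : BPath G) (U : Set (BPath G)) (hU : IsOpen U) (hxU : x ∈ U) :
    ∃ t ∈ Γ, (∀ z, t (t z) = z) ∧ t x ≠ x ∧ ∀ z, t z ≠ z → z ∈ U := by
  obtain ⟨a, haF, haa, hax, haU⟩ := swap_at hs hK hW hI x U hU hxU
  obtain ⟨W, hWo, hxW, hWU, hWd⟩ := exists_off_nhd a hax hU hxU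
  obtain ⟨b, hbF, hbb, hbx, hbW⟩ := swap_at hs hK hW hI x W hWo hxW
  obtain ⟨h1, h2, h3, h4⟩ := comm_facts (a := a) (g := b) (h := (⁅a, b⁆ : BPath G ≃ₜ BPath G))
    haa hbb hWd hbW (comm_apply haa hbb)
  refine ⟨⁅a, b⁆, hΓc a b haF hbF, h1, by rw [h3 x hxW]; exact hbx, fun z hz => ?_⟩
  rcases h4 z hz with h | h
  · exact hWU h
  · by_cases c : a z = z
    · rw [c] at h; exact hWU h
    · exact haU z c

theorem gamma_p2 (hs : ∀ v, ¬ IsSink G v) (hK : CondK G) (hW : CondW G) (hI : CondInf G)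
    (Γ : Subgroup (BPath G ≃ₜ BPath G))
    (hΓ : ∀ γ ∈ Γ, InFullGroup G γ)
    (hΓc : ∀ α β : BPath G ≃ₜ BPath G, InFullGroup G α → InFullGroup G β → ⁅α, β⁆ ∈ Γ)
    (τ : BPath G ≃ₜ BPath G) (hτ : τ ∈ Γ) (hinv : ∀ z, τ (τ z) = z) (x : BPath G)
    (hx : τ x ≠ x) (U : Set (BPath G)) (hU : IsOpen U) (hxU : x ∈ U) :
    ∃ b ∈ Γ, b x ≠ x ∧ ∀ z, b z ≠ z → b z = τ z ∧ (z ∈ U ∨ τ z ∈ U) := by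
  obtain ⟨a, B, haF, hBo, hxB, hBU, haa, haB, hBd, haS⟩ := restrict_at hs (hΓ τ hτ) hx hU hxU
  obtain ⟨g, hgF, hgg, hgx, hgB⟩ := swap_at hs hK hW hI x B hBo hxB
  have hBd' : ∀ z ∈ B, a z ∉ B := fun z hz => by rw [haB z hz]; exact hBd z hz
  obtain ⟨h1, h2, h3, h4⟩ := comm_facts (a := a) (g := g) (h := (⁅a, g⁆ : BPath G ≃ₜ BPath G))
    haa hgg hBd' hgB (comm_apply haa hgg)
  have hhΓ : ⁅a, g⁆ ∈ Γ := hΓc a g haF hgF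
  generalize (⁅a, g⁆ : BPath G ≃ₜ BPath G) = h at h1 h2 h3 h4 hhΓ
  obtain ⟨W, hWo, hxW, hWB, hWd⟩ := exists_off_nhd g hgx hBo hxB
  obtain ⟨a', B', haF', hBo', hxB', hBU', haa', haB', hBd2, haS'⟩ :=
    restrict_at hs (hΓ τ hτ) hx hWo hxW
  have key : ∀ z, a' z = z ∨ a' z = a z := by
    intro z
    by_cases c : a' z = z
    · exact Or.inl c
    · right
      rcases haS' z c with hz | ⟨w, hw, rfl⟩
      · rw [haB' z hz, haB z (hWB (hBU' hz))]
      · rw [← haB' w hw, haa', haB' w hw, ← haB w (hWB (hBU' hw)), haa]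
  have hgxB : g x ∈ B := hgB _ (by rw [hgg]; exact hgx.symm)
  have hfix : a' (g x) = g x := by
    by_contra c
    rcases haS' _ c with hz | ⟨w, hw, e⟩
    · exact hWd x hxW (hBU' hz)
    · exact hBd w (hWB (hBU' hw)) (e ▸ hgxB)
  refine ⟨⁅a', h⁆, hΓc a' h haF' (hΓ h hhΓ), ?_, fun z hz => ?_⟩
  · rw [comm_apply haa' h1, h3 x hxB, hfix, h3 _ hgxB, hgg, haB' x hxB']
    exact hx
  · have hz2 : (⁅a', h⁆ : BPath G ≃ₜ BPath G) z = a z := by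
      have e1 : h (a' (h z)) = z ∨ h (a' (h z)) = a z := by
        rcases key (h z) with c | c
        · left; rw [c, h1]
        · right; rw [c, ← h2, h1]
      have e2 := comm_apply haa' h1 z
      rw [e2] at hz ⊢
      rcases e1 with c | c
      · rw [c] at hz ⊢
        exact (key z).resolve_left hz
      · rw [c] at hz ⊢
        rcases key (a z) with c' | c'
        · exact c'
        · rw [c', haa] at hz
          exact absurd rfl hz
    rw [hz2] at hz ⊢
    rcases haS z hz with hzB | ⟨w, hw, rfl⟩
    · exact ⟨haB z hzB, Or.inl (hBU hzB)⟩
    · rw [hinv]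
      refine ⟨?_, Or.inr (hBU hw)⟩
      rw [← haB w hw, haa]


/-- Evaluation action of a group of homeomorphisms. -/
@[reducible] def evalAction {X : Type*} [TopologicalSpace X] (Γ : Subgroup (X ≃ₜ X)) :
    MulAction Γ X where
  smul γ x := γ.1 x
  one_smul _ := rfl
  mul_smul _ _ _ := rfl

theorem gamma_good (hs : ∀ v, ¬ IsSink G v) (hK : CondK G) (hW : CondW G) (hI : CondInf G)
    (Γ : Subgroup (BPath G ≃ₜ BPath G))
    (hΓ : ∀ γ ∈ Γ, InFullGroup G γ)
    (hΓc : ∀ α β : BPath G ≃ₜ BPath G, InFullGroup G α → InFullGroup G β → ⁅α, β⁆ ∈ Γ) :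
    @SRGood Γ (BPath G) _ (evalAction Γ) _ := by
  letI := evalAction Γ
  have hsq : ∀ t : Γ, t * t = 1 → ∀ z, t.1 (t.1 z) = z := fun t ht z =>
    congrArg (fun s : Γ => s.1 z) ht
  refine ⟨inferInstance, fun a => a.1.continuous, fun a ha => ?_, fun x U hU hx => ?_,
    fun t ht x hx U hU hxU => ?_, fun t ht => ?_⟩
  · exact Subtype.ext (Homeomorph.ext ha)
  · obtain ⟨t, htΓ, htt, htx, htU⟩ := gamma_p1 hs hK hW hI Γ hΓc x U hU hx
    exact ⟨⟨t, htΓ⟩, Subtype.ext (Homeomorph.ext htt), htx, htU⟩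
  · obtain ⟨b, hbΓ, hbx, hb⟩ := gamma_p2 hs hK hW hI Γ hΓ hΓc t.1 t.2 (hsq t ht) x hx U hU hxU
    exact ⟨⟨b, hbΓ⟩, hbx, hb⟩
  · exact isCompact_supp hs hK hW hI (hΓ t.1 t.2) (hsq t ht)

end Local

/-- Let `E` and `F` be graphs with no sinks satisfying Conditions (K), (W)
and (∞), and let `Γ` (resp. `Λ`) be a subgroup of the topological full group `G_E` (resp.
`G_F`) containing the commutator subgroup of `G_E` (resp. `G_F`). Then every abstract group
isomorphism `Φ : Γ → Λ` is spatially implemented by a homeomorphism `∂E → ∂F`. -/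
theorem statement2 {V₁ E₁ V₂ E₂ : Type*} (G : DGraph V₁ E₁) (H : DGraph V₂ E₂)
    (hs₁ : ∀ v, ¬ IsSink G v) (hs₂ : ∀ v, ¬ IsSink H v)
    (hK₁ : CondK G) (hW₁ : CondW G) (hI₁ : CondInf G)
    (hK₂ : CondK H) (hW₂ : CondW H) (hI₂ : CondInf H)
    (Γ : Subgroup (BPath G ≃ₜ BPath G)) (Λ : Subgroup (BPath H ≃ₜ BPath H))
    (hΓ : ∀ γ ∈ Γ, InFullGroup G γ)
    (hΓc : ∀ α β : BPath G ≃ₜ BPath G, InFullGroup G α → InFullGroup G β → ⁅α, β⁆ ∈ Γ)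
    (hΛ : ∀ γ ∈ Λ, InFullGroup H γ)
    (hΛc : ∀ α β : BPath H ≃ₜ BPath H, InFullGroup H α → InFullGroup H β → ⁅α, β⁆ ∈ Λ)
    (Φ : Γ ≃* Λ) :
    ∃ φ : BPath G ≃ₜ BPath H, ∀ γ : Γ,
      ⇑((Φ γ : Λ) : BPath H ≃ₜ BPath H) =
        ⇑φ ∘ ⇑((γ : Γ) : BPath G ≃ₜ BPath G) ∘ ⇑φ.symm := by
  letI := evalAction Γ
  letI := evalAction Λ
  obtain ⟨φ, hφ⟩ := sr_recon (gamma_good hs₁ hK₁ hW₁ hI₁ Γ hΓ hΓc)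
    (gamma_good hs₂ hK₂ hW₂ hI₂ Λ hΛ hΛc) Φ
  refine ⟨φ, fun γ => funext fun y => ?_⟩
  have h := hφ γ (φ.symm y)
  rw [φ.apply_symm_apply] at h
  exact h.symm
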